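/- Let n ≥ 2 and α ∈ ℝ, and let μ_{n,α} := inf{ ∫_{ℝⁿ} |x|^α |Δu|² dx / ∫_{ℝⁿ} |x|^{α−4} |u|² dx : u ∈ C²_c(ℝⁿ∖{0}), u ≠ 0 } = min over integers k ≥ 0 of |γ_{n,α} + k(n−2+k)|². Then μ_{n,α} = 0 if and only if α ∈ {n + 2k : k ∈ ℕ∪{0}} ∪ {4 − n − 2k : k ∈ ℕ∪{0}}. -/

import Mathlib

open MeasureTheory Metric Set Filter
open scoped RealInnerProductSpace

noncomputable section

/-- The Euclidean Laplacian of `u : ℝⁿ → ℝ` at a point. -/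
def lap {n : ℕ} (u : EuclideanSpace ℝ (Fin n) → ℝ) (x : EuclideanSpace ℝ (Fin n)) : ℝ :=
  ∑ i : Fin n, iteratedFDeriv ℝ 2 u x ![EuclideanSpace.single i 1, EuclideanSpace.single i 1]

/-- The Laplace–Beltrami operator on the unit sphere, computed via the
`0`-homogeneous extension: for a `0`-homogeneous function the Euclidean Laplacian
restricted to the unit sphere is exactly the Laplace–Beltrami operator. -/
def sphLap {n : ℕ} (φ : EuclideanSpace ℝ (Fin n) → ℝ) (σ : EuclideanSpace ℝ (Fin n)) : ℝ :=
  lap (fun x => φ (‖x‖⁻¹ • x)) σ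

/-- Squared norm of the spherical gradient, via the `0`-homogeneous extension. -/
def sphGradNormSq {n : ℕ} (φ : EuclideanSpace ℝ (Fin n) → ℝ) (σ : EuclideanSpace ℝ (Fin n)) : ℝ :=
  ‖fderiv ℝ (fun x => φ (‖x‖⁻¹ • x)) σ‖ ^ 2

/-- The open cone `C_Σ = {rσ : r > 0, σ ∈ Σ}` over a subset of the unit sphere. -/
def coneOf {n : ℕ} (S : Set (EuclideanSpace ℝ (Fin n))) : Set (EuclideanSpace ℝ (Fin n)) :=
  {x | x ≠ 0 ∧ ‖x‖⁻¹ • x ∈ S}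

/-- The canonical surface measure `dσ` on the unit sphere of `ℝⁿ`, as a measure on `ℝⁿ`. -/
def sphMeasure (n : ℕ) : Measure (EuclideanSpace ℝ (Fin n)) :=
  Measure.map Subtype.val
    ((volume : Measure (EuclideanSpace ℝ (Fin n))).toSphere)

/-- A (Dirichlet) eigenfunction of the Laplace–Beltrami operator on `S ⊆ 𝕊^{n-1}`
relative to the eigenvalue `lam`. -/
def IsEigenfun {n : ℕ} (S : Set (EuclideanSpace ℝ (Fin n))) (lam : ℝ)
    (φ : EuclideanSpace ℝ (Fin n) → ℝ) : Prop :=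
  ContinuousOn (fun x => φ (‖x‖⁻¹ • x)) (coneOf (closure S)) ∧
  ContDiffOn ℝ 2 (fun x => φ (‖x‖⁻¹ • x)) (coneOf S) ∧
  (∀ σ ∈ closure S \ S, φ σ = 0) ∧
  (∃ σ ∈ S, φ σ ≠ 0) ∧
  (∀ σ ∈ S, - sphLap φ σ = lam * φ σ)

/-- The Dirichlet spectrum `Λ(Σ)` of the Laplace–Beltrami operator on `S`. -/
def spec {n : ℕ} (S : Set (EuclideanSpace ℝ (Fin n))) : Set ℝ :=
  {lam | ∃ φ, IsEigenfun S lam φ}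

/-- `S` is a domain in the unit sphere `𝕊^{n-1}`: a relatively open connected
nonempty subset. -/
def IsSphDomain {n : ℕ} (S : Set (EuclideanSpace ℝ (Fin n))) : Prop :=
  S ⊆ Metric.sphere (0 : EuclideanSpace ℝ (Fin n)) 1 ∧
  IsOpen (Subtype.val ⁻¹' S : Set (Metric.sphere (0 : EuclideanSpace ℝ (Fin n)) 1)) ∧
  IsConnected S

/-- `S` is a domain of class `C²` in the unit sphere: a domain such that the cone
over it admits local `C²` defining functions away from the origin. -/
def IsC2SphDomain {n : ℕ} (S : Set (EuclideanSpace ℝ (Fin n))) : Prop :=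
  IsSphDomain S ∧
  ∀ x ∈ frontier (coneOf S) \ {0}, ∃ (U : Set (EuclideanSpace ℝ (Fin n)))
    (f : EuclideanSpace ℝ (Fin n) → ℝ), IsOpen U ∧ x ∈ U ∧ ContDiff ℝ 2 f ∧
    fderiv ℝ f x ≠ 0 ∧ coneOf S ∩ U = {y ∈ U | f y < 0}

/-- `γ_{n,α} = ((n-2)/2)² - ((α-2)/2)²`. -/
def gam (n : ℕ) (α : ℝ) : ℝ := (((n : ℝ) - 2) / 2) ^ 2 - ((α - 2) / 2) ^ 2

/-- `γ̄_{n,α} = ((n-2)/2)² + ((α-2)/2)²`. -/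
def gbar (n : ℕ) (α : ℝ) : ℝ := (((n : ℝ) - 2) / 2) ^ 2 + ((α - 2) / 2) ^ 2

/-- The class `C²_c(Ω̄ ∖ {0})` of Navier test functions: `C²` up to the closure of
`Ω`, vanishing on `∂Ω` and in a neighborhood of `0` and of `∞`. -/
def NavierAdm {n : ℕ} (Ω : Set (EuclideanSpace ℝ (Fin n)))
    (u : EuclideanSpace ℝ (Fin n) → ℝ) : Prop :=
  ContDiffOn ℝ 2 u (closure Ω) ∧
  (∀ x ∈ frontier Ω, u x = 0) ∧
  (∃ ε > 0, ∀ x : EuclideanSpace ℝ (Fin n), ‖x‖ < ε → u x = 0) ∧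
  (∃ R : ℝ, ∀ x : EuclideanSpace ℝ (Fin n), R < ‖x‖ → u x = 0)

/-- The class `C²_c(Ω)` of Dirichlet test functions: globally `C²` with compact
support contained in `Ω`. -/
def DirichletAdm {n : ℕ} (Ω : Set (EuclideanSpace ℝ (Fin n)))
    (u : EuclideanSpace ℝ (Fin n) → ℝ) : Prop :=
  ContDiff ℝ 2 u ∧ HasCompactSupport u ∧ tsupport u ⊆ Ω

/-- The best Rellich constant `μ_N(Ω;α)` under Navier boundary conditions. -/
def muN {n : ℕ} (Ω : Set (EuclideanSpace ℝ (Fin n))) (α : ℝ) : ℝ :=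
  sInf {q : ℝ | ∃ u, NavierAdm Ω u ∧ (∃ x ∈ Ω, u x ≠ 0) ∧
    q = (∫ x in Ω, ‖x‖ ^ α * (lap u x) ^ 2) / (∫ x in Ω, ‖x‖ ^ (α - 4) * (u x) ^ 2)}

/-- The best Rellich constant `μ_D(Ω;α)` under Dirichlet boundary conditions. -/
def muD {n : ℕ} (Ω : Set (EuclideanSpace ℝ (Fin n))) (α : ℝ) : ℝ :=
  sInf {q : ℝ | ∃ u, DirichletAdm Ω u ∧ (∃ x ∈ Ω, u x ≠ 0) ∧
    q = (∫ x in Ω, ‖x‖ ^ α * (lap u x) ^ 2) / (∫ x in Ω, ‖x‖ ^ (α - 4) * (u x) ^ 2)}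

/-- The surrogate of `H² ∩ H¹₀(Σ)`: functions whose `0`-homogeneous extension is
`C²` up to the closure of the cone, vanishing on the relative boundary of `S`. -/
def NavAdmS {n : ℕ} (S : Set (EuclideanSpace ℝ (Fin n)))
    (φ : EuclideanSpace ℝ (Fin n) → ℝ) : Prop :=
  ContDiffOn ℝ 2 (fun x => φ (‖x‖⁻¹ • x)) (coneOf (closure S)) ∧
  (∀ σ ∈ closure S \ S, φ σ = 0)

/-- The surrogate of `H²₀(Σ)`: as `NavAdmS`, with in addition vanishing gradient
on the relative boundary of `S`. -/
def DirAdmS {n : ℕ} (S : Set (EuclideanSpace ℝ (Fin n)))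
    (φ : EuclideanSpace ℝ (Fin n) → ℝ) : Prop :=
  NavAdmS S φ ∧
  ∀ σ ∈ closure S \ S,
    fderivWithin ℝ (fun x => φ (‖x‖⁻¹ • x)) (coneOf (closure S)) σ = 0

/-- The Rayleigh-type quotient `∫_Σ |Lφ|² dσ / ∫_Σ |φ|² dσ` with
`Lφ = -Δ_σ φ + γ φ`. -/
def sphQuot {n : ℕ} (S : Set (EuclideanSpace ℝ (Fin n))) (γ : ℝ)
    (φ : EuclideanSpace ℝ (Fin n) → ℝ) : ℝ :=
  (∫ σ in S, (- sphLap φ σ + γ * φ σ) ^ 2 ∂(sphMeasure n)) /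
    (∫ σ in S, (φ σ) ^ 2 ∂(sphMeasure n))

/-- Partial derivative `w_s` of a function on the cylinder `ℝ × 𝕊^{n-1}`. -/
def ws {n : ℕ} (w : ℝ × EuclideanSpace ℝ (Fin n) → ℝ)
    (p : ℝ × EuclideanSpace ℝ (Fin n)) : ℝ :=
  deriv (fun t => w (t, p.2)) p.1

/-- Second partial derivative `w_ss` of a function on the cylinder. -/
def wss {n : ℕ} (w : ℝ × EuclideanSpace ℝ (Fin n) → ℝ)
    (p : ℝ × EuclideanSpace ℝ (Fin n)) : ℝ :=
  deriv (fun t => ws w (t, p.2)) p.1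

end

noncomputable section

/-- The set of Rellich quotients over nonzero `u ∈ C²_c(ℝⁿ ∖ {0})`. -/
def RellichRatioSet (n : ℕ) (α : ℝ) : Set ℝ :=
  {q : ℝ | ∃ u : EuclideanSpace ℝ (Fin n) → ℝ,
    DirichletAdm {(0 : EuclideanSpace ℝ (Fin n))}ᶜ u ∧ (∃ x, u x ≠ 0) ∧
    q = (∫ x, ‖x‖ ^ α * (lap u x) ^ 2) / (∫ x, ‖x‖ ^ (α - 4) * (u x) ^ 2)}

/-! ### Part 1: harmonic polynomials -/

section Algebra
open MvPolynomial

/-- formal Laplacian -/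
def mlap (n : ℕ) : MvPolynomial (Fin n) ℝ →ₗ[ℝ] MvPolynomial (Fin n) ℝ :=
  ∑ i : Fin n, ((pderiv i).toLinearMap ∘ₗ (pderiv i).toLinearMap)

lemma mlap_apply {n : ℕ} (p : MvPolynomial (Fin n) ℝ) :
    mlap n p = ∑ i : Fin n, pderiv i (pderiv i p) := by
  simp [mlap]

/-- `|x|²` -/
def rsq (n : ℕ) : MvPolynomial (Fin n) ℝ := ∑ i : Fin n, X i ^ 2

lemma rsq_hom (n : ℕ) : (rsq n).IsHomogeneous 2 :=
  IsHomogeneous.sum _ _ _ fun i _ => by simpa using (isHomogeneous_X ℝ i).pow 2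

lemma pderiv_rsq {n : ℕ} (i : Fin n) : pderiv i (rsq n) = 2 * X i := by
  classical
  rw [rsq, map_sum, Finset.sum_eq_single i]
  · rw [pderiv_pow]; simp
  · intro j _ hj
    rw [pderiv_pow, pderiv_X_of_ne hj]; simp
  · simp

lemma mlap_rsq_mul {n m : ℕ} {p : MvPolynomial (Fin n) ℝ} (hp : p.IsHomogeneous m) :
    mlap n (rsq n * p) = C (2 * (n:ℝ) + 4 * m) * p + rsq n * mlap n p := by
  have he := hp.sum_X_mul_pderiv
  have : ∀ i : Fin n, pderiv i (pderiv i (rsq n * p)) =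
      2 * p + 4 * (X i * pderiv i p) + rsq n * pderiv i (pderiv i p) := by
    intro i
    have h2 : pderiv i (2 : MvPolynomial (Fin n) ℝ) = 0 := by
      exact pderiv_C (R := ℝ) (a := 2) (i := i)
    simp only [pderiv_mul, map_add, pderiv_rsq, h2, pderiv_X_self]
    ring
  rw [mlap_apply, mlap_apply, Finset.sum_congr rfl fun i _ => this i, Finset.sum_add_distrib,
    Finset.sum_add_distrib, ← Finset.mul_sum, ← Finset.mul_sum, he,
    show (C (2 * (n:ℝ) + 4 * m) : MvPolynomial (Fin n) ℝ) = 2 * (n : MvPolynomial (Fin n) ℝ) + 4 * m by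
      simp only [map_add, map_mul, map_natCast]; rfl, ← Finset.mul_sum]
  simp
  ring

/-- homogeneous harmonic polynomials of degree `k` -/
def Harm (n k : ℕ) : Submodule ℝ (MvPolynomial (Fin n) ℝ) :=
  homogeneousSubmodule (Fin n) ℝ k ⊓ LinearMap.ker (mlap n)

lemma mem_Harm {n k : ℕ} {p : MvPolynomial (Fin n) ℝ} :
    p ∈ Harm n k ↔ p.IsHomogeneous k ∧ mlap n p = 0 := by
  simp [Harm]

instance (n k : ℕ) : FiniteDimensional ℝ (Harm n k) := by
  have := homogeneousSubmodule_fg (R := ℝ) (σ := Fin n) k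
  have : FiniteDimensional ℝ (homogeneousSubmodule (Fin n) ℝ k) := Module.Finite.iff_fg.mpr this
  exact Submodule.finiteDimensional_inf_left _ _

lemma mlap_rsq_pow {n : ℕ} (hn : 1 ≤ n) {d : ℕ} {h : MvPolynomial (Fin n) ℝ} (hh : h ∈ Harm n d)
    (j : ℕ) : ∃ c : ℝ, 0 < c ∧ mlap n (rsq n ^ (j+1) * h) = C c * (rsq n ^ j * h) := by
  rw [mem_Harm] at hh
  have hn' : (1:ℝ) ≤ n := by exact_mod_cast hn
  induction j with
  | zero =>
    refine ⟨2 * (n:ℝ) + 4 * d, by positivity, ?_⟩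
    simp [mlap_rsq_mul hh.1, hh.2]
  | succ j ih =>
    obtain ⟨c, hc, h1⟩ := ih
    refine ⟨2 * (n:ℝ) + 4 * ((2 * (j+1) + d : ℕ):ℝ) + c, by positivity, ?_⟩
    have hom : (rsq n ^ (j+1) * h).IsHomogeneous (2 * (j+1) + d) := ((rsq_hom n).pow (j+1)).mul hh.1
    rw [pow_succ' _ (j+1), mul_assoc, mlap_rsq_mul hom, h1]
    simp
    ring

/-- span of the Fischer components -/
def Fis (n m : ℕ) : Submodule ℝ (MvPolynomial (Fin n) ℝ) :=
  Submodule.span ℝ {q | ∃ j d : ℕ, ∃ h ∈ Harm n d, 2 * j + d = m ∧ q = rsq n ^ j * h}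

lemma Fis_hom {n m : ℕ} {q : MvPolynomial (Fin n) ℝ} (hq : q ∈ Fis n m) : q.IsHomogeneous m := by
  suffices Fis n m ≤ homogeneousSubmodule (Fin n) ℝ m from this hq
  rw [Fis, Submodule.span_le]
  rintro _ ⟨j, d, h, hh, rfl, rfl⟩
  rw [mem_Harm] at hh
  exact ((rsq_hom n).pow j).mul hh.1

lemma Fis_solve {n m : ℕ} (hn : 1 ≤ n) {q : MvPolynomial (Fin n) ℝ} (hq : q ∈ Fis n m) :
    ∃ q' ∈ Fis n (m+2), mlap n q' = q := by
  induction hq using Submodule.span_induction with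
  | mem x hx =>
    obtain ⟨j, d, h, hh, hm, rfl⟩ := hx
    obtain ⟨c, hc, h1⟩ := mlap_rsq_pow hn hh j
    refine ⟨c⁻¹ • (rsq n ^ (j+1) * h), Submodule.smul_mem _ _ (Submodule.subset_span
      ⟨j+1, d, h, hh, by omega, rfl⟩), ?_⟩
    rw [map_smul, h1, ← smul_eq_C_mul, smul_smul, inv_mul_cancel₀ hc.ne', one_smul]
  | zero => exact ⟨0, Submodule.zero_mem _, by simp⟩
  | add x y _ _ hx hy =>
    obtain ⟨x', hx', rfl⟩ := hx
    obtain ⟨y', hy', rfl⟩ := hy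
    exact ⟨x' + y', Submodule.add_mem _ hx' hy', by simp⟩
  | smul a x _ hx =>
    obtain ⟨x', hx', rfl⟩ := hx
    exact ⟨a • x', Submodule.smul_mem _ _ hx', by simp⟩

lemma pderiv_hom_zero {n : ℕ} {q : MvPolynomial (Fin n) ℝ} (hq : q.IsHomogeneous 0) (i : Fin n) :
    pderiv i q = 0 := by
  have := (totalDegree_eq_zero_iff_eq_C (p := q)).1 (by
    rcases eq_or_ne q 0 with rfl | h
    · simp
    · exact hq.totalDegree h)
  rw [this]; simp

lemma mem_Fis {n : ℕ} (hn : 1 ≤ n) (m : ℕ) : ∀ q : MvPolynomial (Fin n) ℝ, q.IsHomogeneous m →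
    q ∈ Fis n m := by
  have harm : ∀ m (q : MvPolynomial (Fin n) ℝ), q ∈ Harm n m → q ∈ Fis n m := fun m q hq =>
    Submodule.subset_span ⟨0, m, q, hq, by simp, by simp⟩
  induction m using Nat.strong_induction_on with
  | _ m ih =>
    intro q hq
    match m, ih, hq with
    | 0, _, hq =>
      exact harm _ _ (mem_Harm.2 ⟨hq, by simp [mlap_apply, pderiv_hom_zero hq]⟩)
    | 1, _, hq =>
      exact harm _ _ (mem_Harm.2 ⟨hq, by
        rw [mlap_apply]
        exact Finset.sum_eq_zero fun i _ => pderiv_hom_zero (by simpa using hq.pderiv (i := i)) i⟩)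
    | m+2, ih, hq =>
      have h1 : (mlap n q).IsHomogeneous m := by
        rw [mlap_apply]
        exact IsHomogeneous.sum _ _ _ fun i _ => by
          simpa using (hq.pderiv (i := i)).pderiv (i := i)
      obtain ⟨q', hq', h2⟩ := Fis_solve hn (ih m (by omega) _ h1)
      have h3 : q - q' ∈ Harm n (m+2) := mem_Harm.2 ⟨hq.sub (Fis_hom hq'), by simp [h2]⟩
      simpa using Submodule.add_mem _ (harm _ _ h3) hq'

def cpow {n : ℕ} (i0 i1 : Fin n) : ℕ → MvPolynomial (Fin n) ℝ × MvPolynomial (Fin n) ℝ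
  | 0 => (1, 0)
  | k+1 => (X i0 * (cpow i0 i1 k).1 - X i1 * (cpow i0 i1 k).2,
      X i0 * (cpow i0 i1 k).2 + X i1 * (cpow i0 i1 k).1)

lemma cpow_hom {n : ℕ} (i0 i1 : Fin n) (k : ℕ) :
    (cpow i0 i1 k).1.IsHomogeneous k ∧ (cpow i0 i1 k).2.IsHomogeneous k := by
  induction k with
  | zero => exact ⟨isHomogeneous_one _ _, isHomogeneous_zero _ _ _⟩
  | succ k ih =>
    have h := fun i : Fin n => isHomogeneous_X ℝ i
    simp only [cpow]
    rw [add_comm k 1]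
    exact ⟨((h i0).mul ih.1).sub ((h i1).mul ih.2), ((h i0).mul ih.2).add ((h i1).mul ih.1)⟩

lemma cpow_CR {n : ℕ} {i0 i1 : Fin n} (h01 : i0 ≠ i1) (k : ℕ) :
    (pderiv i0 (cpow i0 i1 k).1 = pderiv i1 (cpow i0 i1 k).2) ∧
    (pderiv i1 (cpow i0 i1 k).1 = - pderiv i0 (cpow i0 i1 k).2) ∧
    ∀ i, i ≠ i0 → i ≠ i1 → pderiv i (cpow i0 i1 k).1 = 0 ∧ pderiv i (cpow i0 i1 k).2 = 0 := by
  induction k with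
  | zero => simp [cpow]
  | succ k ih =>
    obtain ⟨h1, h2, h3⟩ := ih
    simp only [cpow]
    refine ⟨?_, ?_, ?_⟩
    · simp only [map_sub, map_add, pderiv_mul, pderiv_X_self, pderiv_X_of_ne h01, pderiv_X_of_ne h01.symm, h1, h2]
      ring
    · simp only [map_sub, map_add, pderiv_mul, pderiv_X_self, pderiv_X_of_ne h01, pderiv_X_of_ne h01.symm, h1, h2]
      ring
    · intro i hi0 hi1
      obtain ⟨h4, h5⟩ := h3 i hi0 hi1
      simp [pderiv_mul, pderiv_X_of_ne hi0.symm, pderiv_X_of_ne hi1.symm, h4, h5]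

lemma pderiv_comm' {n : ℕ} (i j : Fin n) (p : MvPolynomial (Fin n) ℝ) :
    pderiv i (pderiv j p) = pderiv j (pderiv i p) := by
  have : ⁅(pderiv i : Derivation ℝ (MvPolynomial (Fin n) ℝ) (MvPolynomial (Fin n) ℝ)),
      (pderiv j : Derivation ℝ (MvPolynomial (Fin n) ℝ) (MvPolynomial (Fin n) ℝ))⁆ = 0 := by
    apply MvPolynomial.derivation_ext
    intro k
    classical
    simp [Derivation.commutator_apply, pderiv_X, Pi.single_apply]
    split_ifs <;> simp
  have := congrArg (fun D => D p) this
  simpa [Derivation.commutator_apply, sub_eq_zero] using this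

lemma cpow_harm {n : ℕ} {i0 i1 : Fin n} (h01 : i0 ≠ i1) (k : ℕ) : (cpow i0 i1 k).1 ∈ Harm n k := by
  obtain ⟨h1, h2, h3⟩ := cpow_CR h01 k
  refine mem_Harm.2 ⟨(cpow_hom i0 i1 k).1, ?_⟩
  rw [mlap_apply, ← Finset.add_sum_erase _ _ (Finset.mem_univ i0),
    ← Finset.add_sum_erase _ _ (Finset.mem_erase.2 ⟨h01.symm, Finset.mem_univ i1⟩),
    Finset.sum_eq_zero, h1, h2, map_neg, pderiv_comm' i0 i1]
  · simp
  · intro i hi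
    simp only [Finset.mem_erase] at hi
    simp [(h3 i hi.2.1 hi.1).1]

lemma cpow_eval {n : ℕ} {i0 i1 : Fin n} (h01 : i0 ≠ i1) (k : ℕ) (v : Fin n → ℝ) (h0 : v i0 = 1)
    (h1 : v i1 = 0) : eval v (cpow i0 i1 k).1 = 1 := by
  induction k with
  | zero => simp [cpow]
  | succ k ih => simp [cpow, ih, h0, h1]

end Algebra

/-! ### Part 2: calculus of the Laplacian -/

section Calc
variable {n : ℕ}

/-- partial derivative -/
def pd (i : Fin n) (u : EuclideanSpace ℝ (Fin n) → ℝ) (x : EuclideanSpace ℝ (Fin n)) : ℝ :=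
  fderiv ℝ u x (EuclideanSpace.single i 1)

lemma lap_eq_pd {u : EuclideanSpace ℝ (Fin n) → ℝ} {x : EuclideanSpace ℝ (Fin n)}
    (hu : ContDiffAt ℝ 2 u x) : lap u x = ∑ i, pd i (pd i u) x := by
  have h : DifferentiableAt ℝ (fderiv ℝ u) x :=
    (hu.fderiv_right (m := 1) (by norm_num)).differentiableAt (by norm_num)
  unfold lap pd
  refine Finset.sum_congr rfl fun i _ => ?_
  rw [iteratedFDeriv_two_apply]
  have := (h.hasFDerivAt.clm_apply (hasFDerivAt_const (EuclideanSpace.single i (1:ℝ)) x)).fderiv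
  rw [this]
  simp

lemma lap_congr {u v : EuclideanSpace ℝ (Fin n) → ℝ} {x : EuclideanSpace ℝ (Fin n)}
    (h : u =ᶠ[nhds x] v) : lap u x = lap v x := by
  unfold lap
  rw [(h.iteratedFDeriv ℝ 2).eq_of_nhds]

/-- evaluation of a polynomial -/
def ev (p : MvPolynomial (Fin n) ℝ) (x : EuclideanSpace ℝ (Fin n)) : ℝ := MvPolynomial.eval x.ofLp p

lemma ev_C (a : ℝ) : (ev (MvPolynomial.C a) : EuclideanSpace ℝ (Fin n) → ℝ) = fun _ => a := by
  ext; simp [ev]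

lemma ev_add (p q : MvPolynomial (Fin n) ℝ) : ev (p + q) = fun x => ev p x + ev q x := by
  ext; simp [ev]

lemma ev_mul (p q : MvPolynomial (Fin n) ℝ) : ev (p * q) = fun x => ev p x * ev q x := by
  ext; simp [ev]

lemma ev_X (j : Fin n) : ev (MvPolynomial.X j) = fun x : EuclideanSpace ℝ (Fin n) => x j := by
  ext; simp [ev]

lemma ev_hasFDerivAt (p : MvPolynomial (Fin n) ℝ) (x : EuclideanSpace ℝ (Fin n)) :
    HasFDerivAt (ev p) (∑ i, ev (MvPolynomial.pderiv i p) x •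
      (EuclideanSpace.proj i : EuclideanSpace ℝ (Fin n) →L[ℝ] ℝ)) x := by
  classical
  induction p using MvPolynomial.induction_on with
  | C a =>
    rw [ev_C]
    refine (hasFDerivAt_const (a:ℝ) x).congr_fderiv ?_
    ext v
    simp [ev, MvPolynomial.pderiv_C]
  | add p q hp hq =>
    rw [ev_add]
    refine (hp.fun_add hq).congr_fderiv ?_
    simp only [map_add, ev_add, add_smul, Finset.sum_add_distrib]
  | mul_X p j hp =>
    have h2 : HasFDerivAt (fun y : EuclideanSpace ℝ (Fin n) => y j)
      (EuclideanSpace.proj j : EuclideanSpace ℝ (Fin n) →L[ℝ] ℝ) x :=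
      (EuclideanSpace.proj j : EuclideanSpace ℝ (Fin n) →L[ℝ] ℝ).hasFDerivAt
    rw [ev_mul, ev_X]
    refine (hp.fun_mul h2).congr_fderiv ?_
    have : ∀ i, ev (MvPolynomial.pderiv i (p * MvPolynomial.X j)) x =
        x j * ev (MvPolynomial.pderiv i p) x + (if i = j then ev p x else 0) := by
      intro i
      rw [MvPolynomial.pderiv_mul, ev_add, ev_mul, ev_mul, ev_X]
      by_cases hij : i = j
      · subst hij; simp [ev, mul_comm]
      · simp [hij, MvPolynomial.pderiv_X_of_ne (Ne.symm hij), ev, mul_comm]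
    simp only [this, add_smul, Finset.sum_add_distrib, mul_smul, ← Finset.smul_sum, ite_smul,
      zero_smul, Finset.sum_ite_eq', Finset.mem_univ, if_true]
    rw [add_comm]

lemma ev_contDiff (p : MvPolynomial (Fin n) ℝ) : ContDiff ℝ 2 (ev p) := by
  induction p using MvPolynomial.induction_on with
  | C a => rw [ev_C]; exact contDiff_const
  | add p q hp hq => rw [ev_add]; exact hp.add hq
  | mul_X p j hp =>
    have h2 : ContDiff ℝ 2 (fun y : EuclideanSpace ℝ (Fin n) => y j) :=
      (EuclideanSpace.proj j : EuclideanSpace ℝ (Fin n) →L[ℝ] ℝ).contDiff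
    rw [ev_mul, ev_X]; exact hp.mul h2

lemma ev_continuous (p : MvPolynomial (Fin n) ℝ) : Continuous (ev p) := (ev_contDiff p).continuous

lemma pd_ev (p : MvPolynomial (Fin n) ℝ) (i : Fin n) : pd i (ev p) = ev (MvPolynomial.pderiv i p) := by
  ext x
  simp [pd, (ev_hasFDerivAt p x).fderiv]

lemma lap_ev (p : MvPolynomial (Fin n) ℝ) (x) : lap (ev p) x = ev (mlap n p) x := by
  rw [lap_eq_pd (ev_contDiff p).contDiffAt]
  simp [pd_ev, mlap_apply, ev]

lemma ev_euler {p : MvPolynomial (Fin n) ℝ} {m : ℕ} (hp : p.IsHomogeneous m)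
    (x : EuclideanSpace ℝ (Fin n)) :
    ∑ i, x i * ev (MvPolynomial.pderiv i p) x = m * ev p x := by
  have := congrArg (fun q => ev q x) hp.sum_X_mul_pderiv
  simpa [ev] using this

lemma ev_smul {p : MvPolynomial (Fin n) ℝ} {m : ℕ} (hp : p.IsHomogeneous m)
    (x : EuclideanSpace ℝ (Fin n)) (r : ℝ) : ev p (r • x) = r ^ m * ev p x := by
  unfold ev
  rw [MvPolynomial.eval_eq, MvPolynomial.eval_eq, Finset.mul_sum]
  refine Finset.sum_congr rfl fun d hd => ?_
  have h := hp (MvPolynomial.mem_support_iff.1 hd)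
  rw [Finsupp.weight_apply, Finsupp.sum] at h
  simp only [PiLp.smul_apply, smul_eq_mul, mul_pow, Finset.prod_mul_distrib, Finset.prod_pow_eq_pow_sum,
    ← h, Pi.one_apply, mul_one]
  ring

lemma pd_mul {u v : EuclideanSpace ℝ (Fin n) → ℝ} {x} (i : Fin n) (hu : DifferentiableAt ℝ u x)
    (hv : DifferentiableAt ℝ v x) :
    pd i (fun y => u y * v y) x = pd i u x * v x + u x * pd i v x := by
  unfold pd
  rw [(hu.hasFDerivAt.fun_mul hv.hasFDerivAt).fderiv]
  simp; ring

lemma pd_radial {φ : ℝ → ℝ} {x : EuclideanSpace ℝ (Fin n)} (i : Fin n)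
    (h : DifferentiableAt ℝ φ (‖x‖^2)) :
    pd i (fun y => φ (‖y‖^2)) x = 2 * x i * deriv φ (‖x‖^2) := by
  have h1 : HasFDerivAt (fun y : EuclideanSpace ℝ (Fin n) => ‖y‖^2) (2 • (innerSL ℝ x)) x :=
    (hasStrictFDerivAt_norm_sq x).hasFDerivAt
  have := h.hasDerivAt.comp_hasFDerivAt x h1
  unfold pd
  have h2 := this.fderiv
  simp only [Function.comp_def] at h2
  rw [h2]
  simp [EuclideanSpace.inner_single_right]
  ring

lemma pd_coord (i : Fin n) (x : EuclideanSpace ℝ (Fin n)) : pd i (fun y => y i) x = 1 := by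
  have : HasFDerivAt (fun y : EuclideanSpace ℝ (Fin n) => y i) 
    (EuclideanSpace.proj i : EuclideanSpace ℝ (Fin n) →L[ℝ] ℝ) x :=
    (EuclideanSpace.proj i : EuclideanSpace ℝ (Fin n) →L[ℝ] ℝ).hasFDerivAt
  simp [pd, this.fderiv]

lemma pd_congr {u v : EuclideanSpace ℝ (Fin n) → ℝ} {x} (i : Fin n) (h : u =ᶠ[nhds x] v) :
    pd i u x = pd i v x := by
  unfold pd; rw [h.fderiv_eq]

lemma contDiffAt_radial {φ : ℝ → ℝ} {x : EuclideanSpace ℝ (Fin n)} {m : WithTop ℕ∞}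
    (h : ContDiffAt ℝ m φ (‖x‖^2)) : ContDiffAt ℝ m (fun y : EuclideanSpace ℝ (Fin n) => φ (‖y‖^2)) x :=
  ContDiffAt.comp x h (contDiff_norm_sq ℝ).contDiffAt

lemma lap_radial_mul {φ : ℝ → ℝ} {p : MvPolynomial (Fin n) ℝ} {k : ℕ} (hp : p ∈ Harm n k)
    {x : EuclideanSpace ℝ (Fin n)} (h : ContDiffAt ℝ 2 φ (‖x‖^2)) :
    lap (fun y => φ (‖y‖^2) * ev p y) x =
      (4 * ‖x‖^2 * deriv (deriv φ) (‖x‖^2) + (2 * n + 4 * k) * deriv φ (‖x‖^2)) * ev p x := by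
  rw [mem_Harm] at hp
  have hc : ContDiffAt ℝ 2 (fun y => φ (‖y‖^2) * ev p y) x :=
    (contDiffAt_radial h).mul (ev_contDiff p).contDiffAt
  rw [lap_eq_pd hc]
  have hev : ∀ᶠ t in nhds (‖x‖^2), ContDiffAt ℝ 2 φ t := h.eventually (by simp)
  have hev' : ∀ᶠ y in nhds x, ContDiffAt ℝ 2 φ (‖y‖^2) :=
    ((continuous_norm.pow 2).tendsto x).eventually hev
  have dev : ∀ q y, DifferentiableAt ℝ (ev q : EuclideanSpace ℝ (Fin n) → ℝ) y := fun q y =>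
    (ev_hasFDerivAt q y).differentiableAt
  have key : ∀ i, pd i (pd i (fun y => φ (‖y‖^2) * ev p y)) x =
      (2 * deriv φ (‖x‖^2) + 4 * x i ^ 2 * deriv (deriv φ) (‖x‖^2)) * ev p x
       + 4 * deriv φ (‖x‖^2) * (x i * ev (MvPolynomial.pderiv i p) x)
       + φ (‖x‖^2) * ev (MvPolynomial.pderiv i (MvPolynomial.pderiv i p)) x := by
    intro i
    have e1 : pd i (fun y => φ (‖y‖^2) * ev p y) =ᶠ[nhds x] fun y =>
        (2 * y i * deriv φ (‖y‖^2)) * ev p y + φ (‖y‖^2) * ev (MvPolynomial.pderiv i p) y := by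
      filter_upwards [hev'] with y hy
      rw [pd_mul i ((contDiffAt_radial hy).differentiableAt (by norm_num)) (dev _ _), 
        pd_radial i (hy.differentiableAt (by norm_num)), pd_ev]
    rw [pd_congr i e1]
    have hd : DifferentiableAt ℝ φ (‖x‖^2) := h.differentiableAt (by norm_num)
    have hd' : DifferentiableAt ℝ (deriv φ) (‖x‖^2) := by
      have : ContDiffAt ℝ 1 (deriv φ) (‖x‖^2) := by
        have h3 : deriv φ = fun t => fderiv ℝ φ t 1 := by ext t; simp
        rw [h3]
        exact (h.fderiv_right (m := 1) (by norm_num)).clm_apply contDiffAt_const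
      exact this.differentiableAt (by norm_num)
    have hr : DifferentiableAt ℝ (fun y : EuclideanSpace ℝ (Fin n) => φ (‖y‖^2)) x :=
      DifferentiableAt.comp x hd (contDiff_norm_sq ℝ (n := 1)).contDiffAt.differentiableAt_one
    have hr' : DifferentiableAt ℝ (fun y : EuclideanSpace ℝ (Fin n) => deriv φ (‖y‖^2)) x :=
      DifferentiableAt.comp x (g := deriv φ) hd' (contDiff_norm_sq ℝ (n := 1)).contDiffAt.differentiableAt_one
    have hco : DifferentiableAt ℝ (fun y : EuclideanSpace ℝ (Fin n) => 2 * y i) x := by fun_prop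
    have hA : pd i (fun y : EuclideanSpace ℝ (Fin n) => 2 * y i) x = 2 := by
      have := pd_mul (x := x) i (differentiableAt_const (2:ℝ)) 
        (show DifferentiableAt ℝ (fun y : EuclideanSpace ℝ (Fin n) => y i) x by fun_prop)
      rw [this, pd_coord]
      simp [pd]
    have hadd : ∀ u v : EuclideanSpace ℝ (Fin n) → ℝ, DifferentiableAt ℝ u x → DifferentiableAt ℝ v x →
        pd i (fun y => u y + v y) x = pd i u x + pd i v x := by
      intro u v hu hv
      unfold pd
      rw [(hu.hasFDerivAt.fun_add hv.hasFDerivAt).fderiv]; simp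
    rw [hadd _ _ ((hco.fun_mul hr').fun_mul (dev _ _)) (hr.fun_mul (dev _ _)), pd_mul i (hco.fun_mul hr') (dev _ _),
      pd_mul i hco hr', pd_mul i hr (dev _ _), hA, pd_radial i hd, pd_radial i hd', pd_ev, pd_ev]
    ring
  rw [Finset.sum_congr rfl fun i _ => key i, Finset.sum_add_distrib, Finset.sum_add_distrib,
    ← Finset.sum_mul, ← Finset.mul_sum, ← Finset.mul_sum, ev_euler hp.1]
  have h0 : ∑ i, ev (MvPolynomial.pderiv i (MvPolynomial.pderiv i p)) x = 0 := by
    have := congrArg (fun q => ev q x) hp.2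
    simpa [mlap_apply, ev] using this
  have h1 : ∑ i : Fin n, (2 * deriv φ (‖x‖^2) + 4 * x i ^ 2 * deriv (deriv φ) (‖x‖^2)) =
     n * (2 * deriv φ (‖x‖^2)) + 4 * ‖x‖^2 * deriv (deriv φ) (‖x‖^2) := by
    rw [Finset.sum_add_distrib, EuclideanSpace.norm_sq_eq, Finset.mul_sum, Finset.sum_mul]
    simp
  rw [h0, h1]
  ring

end Calc

/-! ### Part 3: polar coordinates and integration by parts -/

section Polar
variable {n : ℕ}

/-- surface measure -/
abbrev sig (n : ℕ) : Measure (sphere (0 : EuclideanSpace ℝ (Fin n)) 1) :=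
  (volume : Measure (EuclideanSpace ℝ (Fin n))).toSphere

lemma polar (hn : 2 ≤ n) {F : EuclideanSpace ℝ (Fin n) → ℝ} (hF : Integrable F) :
    ∫ x, F x = ∫ r in Ioi (0:ℝ), r ^ (n-1) * ∫ σ, F (r • (σ : EuclideanSpace ℝ (Fin n))) ∂(sig n) := by
  have : Nonempty (Fin n) := ⟨⟨0, by omega⟩⟩
  have hmp := (volume : Measure (EuclideanSpace ℝ (Fin n))).measurePreserving_homeomorphUnitSphereProd
  simp only [finrank_euclideanSpace, Fintype.card_fin] at hmp
  have hme := (homeomorphUnitSphereProd (EuclideanSpace ℝ (Fin n))).measurableEmbedding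
  set G : sphere (0 : EuclideanSpace ℝ (Fin n)) 1 × Ioi (0:ℝ) → ℝ := fun q => F (q.2.1 • q.1.1) with hG
  have hGF : ∀ x : ({0}ᶜ : Set (EuclideanSpace ℝ (Fin n))),
      G (homeomorphUnitSphereProd (EuclideanSpace ℝ (Fin n)) x) = F x := by
    intro x
    have hx : ‖(x : EuclideanSpace ℝ (Fin n))‖ ≠ 0 := norm_ne_zero_iff.2 x.2
    simp [hG, homeomorphUnitSphereProd, smul_smul, mul_inv_cancel₀ hx]
  have hInt0 : Integrable G ((sig n).prod (.volumeIoiPow (n-1))) := by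
    rw [← hmp.integrable_comp_emb hme]
    have : (G ∘ homeomorphUnitSphereProd (EuclideanSpace ℝ (Fin n))) = fun x => F x.1 := by
      ext x; exact hGF x
    rw [this]
    have h2 := integrableOn_iff_comap_subtypeVal (f := F) (μ := volume)
      (s := ({0}ᶜ : Set (EuclideanSpace ℝ (Fin n)))) (measurableSet_singleton _).compl
    exact h2.1 hF.integrableOn
  calc
    ∫ x, F x = ∫ x : ({(0)}ᶜ : Set (EuclideanSpace ℝ (Fin n))), F x.1 ∂(Measure.comap Subtype.val volume) := by
      rw [integral_subtype_comap (measurableSet_singleton _).compl fun x ↦ F x,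
        restrict_compl_singleton]
    _ = ∫ q, G q ∂(sig n).prod (.volumeIoiPow (n-1)) := by
      rw [← hmp.integral_comp hme]
      simp only [hGF]
    _ = ∫ r : Ioi (0:ℝ), ∫ σ, F (r.1 • (σ : EuclideanSpace ℝ (Fin n))) ∂(sig n)
          ∂(.volumeIoiPow (n-1)) := by
      rw [integral_prod_symm _ hInt0]
    _ = _ := by
      simp only [Measure.volumeIoiPow, ENNReal.ofReal]
      rw [integral_withDensity_eq_integral_smul,
        integral_subtype_comap measurableSet_Ioi fun a ↦ Real.toNNReal (a ^ (n - 1)) •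
          ∫ σ, F (a • (σ : EuclideanSpace ℝ (Fin n))) ∂(sig n),
        setIntegral_congr_fun measurableSet_Ioi fun x hx ↦ ?_]
      · change _ = _
        rw [NNReal.smul_def, Real.coe_toNNReal _ (pow_nonneg (le_of_lt hx) _), smul_eq_mul]
      · exact (measurable_subtype_coe.pow_const _).real_toNNReal

lemma polar_ab (hn : 2 ≤ n) {F : EuclideanSpace ℝ (Fin n) → ℝ} (hF : Continuous F) {a b : ℝ}
    (ha : 0 < a) (hab : a ≤ b) (hs : ∀ x, F x ≠ 0 → a ≤ ‖x‖ ∧ ‖x‖ ≤ b) :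
    ∫ x, F x = ∫ r in a..b, r ^ (n-1) * ∫ σ, F (r • (σ : EuclideanSpace ℝ (Fin n))) ∂(sig n) := by
  have hc : HasCompactSupport F := by
    refine HasCompactSupport.intro (isCompact_closedBall (0 : EuclideanSpace ℝ (Fin n)) b) ?_
    intro x hx
    by_contra h
    exact hx (by simpa using (hs x h).2)
  rw [polar hn (hF.integrable_of_hasCompactSupport hc), intervalIntegral.integral_of_le hab,
    ← integral_Icc_eq_integral_Ioc]
  refine setIntegral_eq_of_subset_of_forall_sdiff_eq_zero measurableSet_Ioi
    (show Icc a b ⊆ Ioi 0 from fun r hr => lt_of_lt_of_le ha hr.1) ?_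
  rintro r ⟨hr0, hr⟩
  have : ∀ σ : sphere (0 : EuclideanSpace ℝ (Fin n)) 1, F (r • (σ : EuclideanSpace ℝ (Fin n))) = 0 := by
    intro σ
    by_contra h
    have := hs _ h
    rw [norm_smul, norm_eq_of_mem_sphere, Real.norm_of_nonneg (le_of_lt hr0), mul_one] at this
    exact hr this
  simp [this]

lemma pd_contDiff {u : EuclideanSpace ℝ (Fin n) → ℝ} {m k : WithTop ℕ∞} (hu : ContDiff ℝ m u)
    (hk : k + 1 ≤ m) (i : Fin n) : ContDiff ℝ k (pd i u) :=
  (hu.fderiv_right hk).clm_apply contDiff_const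

lemma pd_compact {u : EuclideanSpace ℝ (Fin n) → ℝ} (hu : HasCompactSupport u) (i : Fin n) :
    HasCompactSupport (pd i u) := by
  have := hu.fderiv (𝕜 := ℝ)
  exact this.comp_left (g := fun L : EuclideanSpace ℝ (Fin n) →L[ℝ] ℝ => L (EuclideanSpace.single i 1)) rfl

lemma ibp1 {u G : EuclideanSpace ℝ (Fin n) → ℝ} (hu : ContDiff ℝ 1 u) (hG : ContDiff ℝ 1 G)
    (hc : HasCompactSupport u) (i : Fin n) :
    ∫ x, u x * pd i G x = - ∫ x, pd i u x * G x := by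
  have h1 := (pd_contDiff (k := 0) hu (by norm_num) i).continuous
  have h2 := (pd_contDiff (k := 0) hG (by norm_num) i).continuous
  refine integral_mul_fderiv_eq_neg_fderiv_mul_of_integrable ?_ ?_ ?_ ?_ ?_
  · exact (h1.mul hG.continuous).integrable_of_hasCompactSupport ((pd_compact hc i).mul_right)
  · exact (hu.continuous.mul h2).integrable_of_hasCompactSupport hc.mul_right
  · exact (hu.continuous.mul hG.continuous).integrable_of_hasCompactSupport hc.mul_right
  · exact fun x _ => hu.differentiable (by norm_num) x
  · exact fun x _ => hG.differentiable (by norm_num) x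

lemma ibp_lap {u G : EuclideanSpace ℝ (Fin n) → ℝ} (hu : ContDiff ℝ 2 u) (hG : ContDiff ℝ 2 G)
    (hc : HasCompactSupport u) : ∫ x, lap u x * G x = ∫ x, u x * lap G x := by
  simp_rw [lap_eq_pd hu.contDiffAt, lap_eq_pd hG.contDiffAt, Finset.sum_mul, Finset.mul_sum]
  have u1 := fun i => pd_contDiff (k := 1) hu (by norm_num) i
  have G1 := fun i => pd_contDiff (k := 1) hG (by norm_num) i
  have u2 := fun i => (pd_contDiff (k := 0) (u1 i) (by norm_num) i).continuous
  have G2 := fun i => (pd_contDiff (k := 0) (G1 i) (by norm_num) i).continuous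
  rw [integral_finsetSum, integral_finsetSum]
  · refine Finset.sum_congr rfl fun i _ => ?_
    rw [ibp1 (hu.of_le (by norm_num)) (G1 i) hc, ibp1 (u1 i) (hG.of_le (by norm_num)) (pd_compact hc i),
      neg_neg]
  · exact fun i _ => (hu.continuous.mul (G2 i)).integrable_of_hasCompactSupport hc.mul_right
  · exact fun i _ => ((u2 i).mul hG.continuous).integrable_of_hasCompactSupport
      (pd_compact (pd_compact hc i) i).mul_right

lemma lap_continuous {u : EuclideanSpace ℝ (Fin n) → ℝ} (hu : ContDiff ℝ 2 u) :
    Continuous (lap u) := by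
  have : lap u = fun x => ∑ i, pd i (pd i u) x := by ext x; exact lap_eq_pd hu.contDiffAt
  rw [this]
  exact continuous_finsetSum _ fun i _ => 
    (pd_contDiff (k := 0) (pd_contDiff (k := 1) hu (by norm_num) i) (by norm_num) i).continuous

/-- annulus containing the support -/
lemma adm_annulus {u : EuclideanSpace ℝ (Fin n) → ℝ} (hu : DirichletAdm {0}ᶜ u) :
    ∃ a b : ℝ, 0 < a ∧ a < b ∧ ∀ x ∈ tsupport u, a < ‖x‖ ∧ ‖x‖ < b := by
  obtain ⟨h1, h2, h3⟩ := hu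
  obtain ⟨b, hb⟩ := h2.isCompact.isBounded.subset_ball (0 : EuclideanSpace ℝ (Fin n))
  have h0 : (0 : EuclideanSpace ℝ (Fin n)) ∈ (tsupport u)ᶜ := fun h => h3 h rfl
  obtain ⟨a, ha, hab⟩ := Metric.isOpen_iff.1 (isClosed_tsupport u).isOpen_compl 0 h0
  refine ⟨a/2, max b (a+1), by positivity, by have := le_max_right b (a+1); linarith, fun x hx => ⟨?_, ?_⟩⟩
  · by_contra h
    exact hab (show x ∈ ball 0 a by simp; linarith) hx
  · have := hb hx
    simp at this
    exact lt_of_lt_of_le this (le_max_left _ _)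

lemma lap_zero_of {u : EuclideanSpace ℝ (Fin n) → ℝ} {x} (hx : x ∉ tsupport u) : lap u x = 0 := by
  have : u =ᶠ[nhds x] fun _ => 0 := notMem_tsupport_iff_eventuallyEq.1 hx
  rw [lap_congr this]
  simp [lap, iteratedFDeriv_two_apply]

lemma continuous_weight {β : ℝ} {f : EuclideanSpace ℝ (Fin n) → ℝ} (hf : Continuous f)
    (h0 : (0 : EuclideanSpace ℝ (Fin n)) ∉ tsupport f) : Continuous fun x => ‖x‖ ^ β * f x := by
  rw [continuous_iff_continuousAt]
  intro x
  by_cases hx : x = 0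
  · subst hx
    have : (fun x => ‖x‖ ^ β * f x) =ᶠ[nhds 0] fun _ => 0 := by
      filter_upwards [notMem_tsupport_iff_eventuallyEq.1 h0] with y hy
      simp [hy]
    exact (continuousAt_const.congr this.symm)
  · exact (continuous_norm.continuousAt.rpow_const (Or.inl (norm_ne_zero_iff.2 hx))).mul hf.continuousAt

end Polar

/-! ### Part 4: the modes of a test function satisfy an ODE -/

section Modes
variable {n : ℕ}

lemma sph_integrable {f : sphere (0 : EuclideanSpace ℝ (Fin n)) 1 → ℝ} (hf : Continuous f) :
    Integrable f (sig n) :=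
  hf.integrable_of_hasCompactSupport (HasCompactSupport.of_compactSpace f)

lemma sph_continuous {F : ℝ → sphere (0 : EuclideanSpace ℝ (Fin n)) 1 → ℝ}
    (hF : Continuous (Function.uncurry F)) : Continuous fun r => ∫ σ, F r σ ∂(sig n) := by
  have := continuous_parametric_integral_of_continuous (μ := sig n) (f := F) hF
    (isCompact_univ : IsCompact (univ : Set (sphere (0 : EuclideanSpace ℝ (Fin n)) 1)))
  simpa using this

lemma sph_hasDerivAt {F F' : ℝ → sphere (0 : EuclideanSpace ℝ (Fin n)) 1 → ℝ}
    (hF : Continuous (Function.uncurry F)) (hF' : Continuous (Function.uncurry F'))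
    (h : ∀ r σ, HasDerivAt (fun s => F s σ) (F' r σ) r) (r : ℝ) :
    HasDerivAt (fun s => ∫ σ, F s σ ∂(sig n)) (∫ σ, F' r σ ∂(sig n)) r := by
  have hFc : ∀ s, Continuous (F s) := fun s => hF.comp (Continuous.prodMk continuous_const continuous_id)
  have hFc' : ∀ s, Continuous (F' s) := fun s => hF'.comp (Continuous.prodMk continuous_const continuous_id)
  obtain ⟨C, hC⟩ := ((isCompact_closedBall r 1).prod
    (isCompact_univ : IsCompact (univ : Set (sphere (0 : EuclideanSpace ℝ (Fin n)) 1)))).exists_bound_of_continuousOn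
      hF'.continuousOn
  refine (hasDerivAt_integral_of_dominated_loc_of_deriv_le (bound := fun _ => C) (F := F) (F' := F')
    (ball_mem_nhds r one_pos) ?_ ?_ ?_ ?_ ?_ ?_).2
  · exact Eventually.of_forall fun s => (hFc s).aestronglyMeasurable
  · exact sph_integrable (hFc r)
  · exact (hFc' r).aestronglyMeasurable
  · refine Eventually.of_forall fun σ s hs => hC (s, σ) ⟨ball_subset_closedBall hs, mem_univ _⟩
  · exact integrable_const _
  · exact Eventually.of_forall fun σ s _ => h s σ

/-- mode -/
def mode (u : EuclideanSpace ℝ (Fin n) → ℝ) (p : MvPolynomial (Fin n) ℝ) (r : ℝ) : ℝ :=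
  ∫ σ : sphere (0 : EuclideanSpace ℝ (Fin n)) 1, u (r • σ.1) * ev p σ.1 ∂(sig n)

lemma mode_continuous {u : EuclideanSpace ℝ (Fin n) → ℝ} (hu : Continuous u)
    (p : MvPolynomial (Fin n) ℝ) : Continuous (mode u p) := by
  refine sph_continuous (F := fun r σ => u (r • σ.1) * ev p σ.1) ?_
  have := ev_continuous (p := p)
  fun_prop

def mode1 (u : EuclideanSpace ℝ (Fin n) → ℝ) (p : MvPolynomial (Fin n) ℝ) (r : ℝ) : ℝ :=
  ∫ σ : sphere (0 : EuclideanSpace ℝ (Fin n)) 1, fderiv ℝ u (r • σ.1) σ.1 * ev p σ.1 ∂(sig n)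

def mode2 (u : EuclideanSpace ℝ (Fin n) → ℝ) (p : MvPolynomial (Fin n) ℝ) (r : ℝ) : ℝ :=
  ∫ σ : sphere (0 : EuclideanSpace ℝ (Fin n)) 1,
    fderiv ℝ (fderiv ℝ u) (r • σ.1) σ.1 σ.1 * ev p σ.1 ∂(sig n)

lemma mode_deriv {u : EuclideanSpace ℝ (Fin n) → ℝ} (hu : ContDiff ℝ 2 u)
    (p : MvPolynomial (Fin n) ℝ) (r : ℝ) : HasDerivAt (mode u p) (mode1 u p r) r := by
  have hp := ev_continuous (p := p)
  have h0 := hu.continuous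
  have h1 := hu.continuous_fderiv (by norm_num)
  refine sph_hasDerivAt (F := fun r σ => u (r • σ.1) * ev p σ.1)
    (F' := fun r σ => fderiv ℝ u (r • σ.1) σ.1 * ev p σ.1) ?_ ?_ ?_ r
  · fun_prop
  · fun_prop
  · intro r σ
    have hd : HasDerivAt (fun s : ℝ => s • σ.1) σ.1 r := by
      simpa using (hasDerivAt_id r).smul_const σ.1
    exact (((hu.differentiable (by norm_num) _).hasFDerivAt).comp_hasDerivAt r hd).mul_const _

lemma mode1_deriv {u : EuclideanSpace ℝ (Fin n) → ℝ} (hu : ContDiff ℝ 2 u)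
    (p : MvPolynomial (Fin n) ℝ) (r : ℝ) : HasDerivAt (mode1 u p) (mode2 u p r) r := by
  have hp := ev_continuous (p := p)
  have hu1 : ContDiff ℝ 1 (fderiv ℝ u) := hu.fderiv_right (by norm_num)
  have h0 := hu1.continuous
  have h1 := hu1.continuous_fderiv (by norm_num)
  refine sph_hasDerivAt (F := fun r σ => fderiv ℝ u (r • σ.1) σ.1 * ev p σ.1)
    (F' := fun r σ => fderiv ℝ (fderiv ℝ u) (r • σ.1) σ.1 σ.1 * ev p σ.1) ?_ ?_ ?_ r
  · fun_prop
  · fun_prop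
  · intro r σ
    have hd : HasDerivAt (fun s : ℝ => s • σ.1) σ.1 r := by
      simpa using (hasDerivAt_id r).smul_const σ.1
    have := (((hu1.differentiable (by norm_num) _).hasFDerivAt).comp_hasDerivAt r hd).clm_apply
      (hasDerivAt_const r σ.1)
    simpa using this.mul_const (ev p σ.1)

lemma mode2_continuous {u : EuclideanSpace ℝ (Fin n) → ℝ} (hu : ContDiff ℝ 2 u)
    (p : MvPolynomial (Fin n) ℝ) : Continuous (mode2 u p) := by
  have hp := ev_continuous (p := p)
  have hu1 : ContDiff ℝ 1 (fderiv ℝ u) := hu.fderiv_right (by norm_num)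
  have h1 := hu1.continuous_fderiv (by norm_num)
  refine sph_continuous (F := fun r σ => fderiv ℝ (fderiv ℝ u) (r • σ.1) σ.1 σ.1 * ev p σ.1) ?_
  fun_prop

lemma sph_norm {r : ℝ} (hr : 0 ≤ r) (σ : sphere (0 : EuclideanSpace ℝ (Fin n)) 1) :
    ‖r • σ.1‖ = r := by
  rw [norm_smul, norm_eq_of_mem_sphere, Real.norm_of_nonneg hr, mul_one]

lemma mode_zero {u : EuclideanSpace ℝ (Fin n) → ℝ} (p : MvPolynomial (Fin n) ℝ) {r : ℝ} (hr : 0 ≤ r)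
    (h : ∀ x ∈ tsupport u, ‖x‖ ≠ r) : mode u p r = 0 ∧ mode1 u p r = 0 := by
  have h1 : ∀ σ : sphere (0 : EuclideanSpace ℝ (Fin n)) 1, r • σ.1 ∉ tsupport u :=
    fun σ hσ => h _ hσ (sph_norm hr σ)
  constructor
  · simp [mode, fun σ => image_eq_zero_of_notMem_tsupport (h1 σ)]
  · simp [mode1, fun σ => fderiv_of_notMem_tsupport (𝕜 := ℝ) (h1 σ)]

lemma hasDerivAt_pow_div (m : ℕ) {r : ℝ} (hr : r ≠ 0) :
    HasDerivAt (fun r : ℝ => r ^ m) (m * r ^ m / r) r := by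
  refine (hasDerivAt_pow m r).congr_deriv ?_
  rcases m with _ | m
  · simp
  · simp only [Nat.add_sub_cancel]; field_simp; ring

/-- smoothness of `g ∘ sqrt` -/
lemma contDiff_sqrt_comp {g : ℝ → ℝ} (hg : ContDiff ℝ 2 g) {a : ℝ} (ha : 0 < a)
    (h : ∀ r < a, g r = 0) : ContDiff ℝ 2 fun t => g (Real.sqrt t) := by
  rw [contDiff_iff_contDiffAt]
  intro t
  rcases le_or_gt t 0 with ht | ht
  · have : (fun t => g (Real.sqrt t)) =ᶠ[nhds t] fun _ => 0 := by
      have h1 : ∀ᶠ s in nhds t, Real.sqrt s < a := by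
        apply Real.continuous_sqrt.continuousAt.eventually_lt continuousAt_const
        rw [Real.sqrt_eq_zero_of_nonpos ht]; exact ha
      filter_upwards [h1] with s hs using h _ hs
    exact contDiffAt_const.congr_of_eventuallyEq this
  · exact hg.contDiffAt.comp t (Real.contDiffAt_sqrt ht.ne')

lemma mode_weak (hn : 2 ≤ n) {u : EuclideanSpace ℝ (Fin n) → ℝ} (hu : DirichletAdm {0}ᶜ u)
    {k : ℕ} {p : MvPolynomial (Fin n) ℝ} (hp : p ∈ Harm n k) {a b : ℝ} (ha : 0 < a) (hab : a < b)
    (hs : ∀ x ∈ tsupport u, a < ‖x‖ ∧ ‖x‖ < b) {ψ : ℝ → ℝ} (hψ : ContDiff ℝ 2 ψ) :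
    ∫ r in a..b, r ^ (n - 1 + k) * ψ (r^2) * mode (lap u) p r =
    ∫ r in a..b, r ^ (n - 1 + k) * mode u p r *
      (4 * r^2 * deriv (deriv ψ) (r^2) + (2*n+4*k) * deriv ψ (r^2)) := by
  have hG : ContDiff ℝ 2 (fun y : EuclideanSpace ℝ (Fin n) => ψ (‖y‖^2) * ev p y) :=
    (hψ.comp (contDiff_norm_sq ℝ)).mul (ev_contDiff p)
  have hψ1 : ContDiff ℝ 1 (deriv ψ) := by
    have : ContDiff ℝ (1+1) ψ := by simpa [one_add_one_eq_two] using hψ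
    exact (contDiff_succ_iff_deriv.1 this).2.2
  have hc1 := hψ1.continuous
  have hc2 : Continuous (deriv (deriv ψ)) := hψ1.continuous_deriv (by norm_num)
  have hcu := hu.1.continuous
  have hcl := lap_continuous hu.1
  have hcp := ev_continuous (p := p)
  have hcψ := hψ.continuous
  have key := ibp_lap hu.1 hG hu.2.1
  have hL : ∀ x, lap (fun y : EuclideanSpace ℝ (Fin n) => ψ (‖y‖^2) * ev p y) x = _ :=
    fun x => lap_radial_mul hp hψ.contDiffAt
  simp_rw [hL] at key
  rw [polar_ab hn (by fun_prop) ha hab.le, polar_ab hn (by fun_prop) ha hab.le] at key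
  rotate_left
  · intro x hx
    have : x ∈ tsupport u := by
      by_contra h; exact hx (by simp [image_eq_zero_of_notMem_tsupport h])
    exact ⟨(hs x this).1.le, (hs x this).2.le⟩
  · intro x hx
    have : x ∈ tsupport u := by
      by_contra h; exact hx (by simp [lap_zero_of h])
    exact ⟨(hs x this).1.le, (hs x this).2.le⟩
  have hom := (mem_Harm.1 hp).1
  convert key using 1
  · refine intervalIntegral.integral_congr fun r hr => ?_
    rw [uIcc_of_le hab.le] at hr
    have hr0 : 0 ≤ r := ha.le.trans hr.1
    simp only [sph_norm hr0, ev_smul hom, mode]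
    rw [← integral_const_mul, ← integral_const_mul]
    congr 1; ext σ; ring
  · refine intervalIntegral.integral_congr fun r hr => ?_
    rw [uIcc_of_le hab.le] at hr
    have hr0 : 0 ≤ r := ha.le.trans hr.1
    simp only [sph_norm hr0, ev_smul hom, mode]
    rw [mul_assoc, mul_comm (∫ σ, _ ∂_) (_ + _), ← integral_const_mul, ← integral_const_mul, ← integral_const_mul]
    congr 1; ext σ; ring

def Lop (n k : ℕ) (f f' f'' : ℝ → ℝ) (r : ℝ) : ℝ :=
  f'' r + (n - 1) / r * f' r - k * (k + n - 2) / r^2 * f r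

lemma mode_weak2 (hn : 2 ≤ n) {k : ℕ} {f f' f'' : ℝ → ℝ} (hf : ∀ r, HasDerivAt f (f' r) r)
    (hf' : ∀ r, HasDerivAt f' (f'' r) r) (hf'' : Continuous f'') 
    {a b : ℝ} (ha : 0 < a) (hab : a < b) (fa : f a = 0) (fb : f b = 0) (fa' : f' a = 0) (fb' : f' b = 0)
    {ψ : ℝ → ℝ} (hψ : ContDiff ℝ 2 ψ) :
    ∫ r in a..b, (r ^ (n - 1 + k) * f r *
      (4 * r^2 * deriv (deriv ψ) (r^2) + (2*n+4*k) * deriv ψ (r^2)) 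
      - r ^ (n - 1 + k) * ψ (r^2) * Lop n k f f' f'' r) = 0 := by
  have hψ1 : ContDiff ℝ 1 (deriv ψ) := by
    have : ContDiff ℝ (1+1) ψ := by simpa [one_add_one_eq_two] using hψ
    exact (contDiff_succ_iff_deriv.1 this).2.2
  have hc1 := hψ1.continuous
  have hc2 : Continuous (deriv (deriv ψ)) := hψ1.continuous_deriv (by norm_num)
  have hcψ := hψ.continuous
  have cf : Continuous f := continuous_iff_continuousAt.2 fun r => (hf r).continuousAt
  have cf' : Continuous f' := continuous_iff_continuousAt.2 fun r => (hf' r).continuousAt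
  have hne : ∀ r ∈ uIcc a b, r ≠ 0 := by
    intro r hr
    rw [uIcc_of_le hab.le] at hr
    exact (lt_of_lt_of_le ha hr.1).ne'
  have key := intervalIntegral.integral_eq_sub_of_hasDerivAt
    (f := fun r => r ^ (n-1+k) * (f r * (k * ψ (r^2) * r⁻¹ + 2 * r * deriv ψ (r^2)) - f' r * ψ (r^2)))
    (f' := fun r => (r ^ (n - 1 + k) * f r *
      (4 * r^2 * deriv (deriv ψ) (r^2) + (2*n+4*k) * deriv ψ (r^2)) 
      - r ^ (n - 1 + k) * ψ (r^2) * Lop n k f f' f'' r)) (a := a) (b := b) ?_ ?_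
  · rw [key]; simp [fa, fb, fa', fb']
  · intro r hr
    have hr0 := hne r hr
    have h2 : HasDerivAt (fun r : ℝ => r^2) (2 * r) r := by simpa using hasDerivAt_pow 2 r
    have hψd : HasDerivAt (fun r => ψ (r^2)) (deriv ψ (r^2) * (2 * r)) r :=
      ((hψ.differentiable (by norm_num) _).hasDerivAt).comp r h2
    have hψd' : HasDerivAt (fun r => deriv ψ (r^2)) (deriv (deriv ψ) (r^2) * (2 * r)) r :=
      ((hψ1.differentiable (by norm_num) _).hasDerivAt).comp r h2
    have hid := (hasDerivAt_id r).const_mul 2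
    have hP := (hasDerivAt_pow_div (n-1+k) hr0).fun_mul
      (((hf r).fun_mul ((((hψd.const_mul (k:ℝ)).fun_mul (hasDerivAt_inv hr0))).fun_add
        (hid.fun_mul hψd'))).fun_sub ((hf' r).fun_mul hψd))
    refine hP.congr_deriv ?_
    simp only [Lop, id]
    have : ((n - 1 + k : ℕ) : ℝ) = n - 1 + k := by
      push_cast [Nat.cast_sub (by omega : 1 ≤ n)]; ring
    rw [this]
    field_simp
    ring
  · apply ContinuousOn.intervalIntegrable
    unfold Lop
    refine ContinuousOn.sub (by fun_prop) (ContinuousOn.mul (by fun_prop) ?_)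
    refine ContinuousOn.sub (ContinuousOn.add (by fun_prop) (ContinuousOn.mul ?_ (by fun_prop)))
      (ContinuousOn.mul ?_ (by fun_prop))
    · exact continuousOn_const.div continuousOn_id hne
    · exact continuousOn_const.div (continuousOn_id.pow 2) fun r hr => pow_ne_zero 2 (hne r hr)

lemma mode_ode (hn : 2 ≤ n) {u : EuclideanSpace ℝ (Fin n) → ℝ} (hu : DirichletAdm {0}ᶜ u)
    {k : ℕ} {p : MvPolynomial (Fin n) ℝ} (hp : p ∈ Harm n k) {a b : ℝ} (ha : 0 < a) (hab : a < b)
    (hs : ∀ x ∈ tsupport u, a < ‖x‖ ∧ ‖x‖ < b) {r : ℝ} (hr : r ∈ Icc a b) :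
    mode (lap u) p r = Lop n k (mode u p) (mode1 u p) (mode2 u p) r := by
  have za := mode_zero p ha.le (fun x hx => (hs x hx).1.ne')
  have zb := mode_zero p (ha.trans hab).le (fun x hx => (hs x hx).2.ne)
  have hpos : ∀ r ∈ Icc a b, 0 < r := fun r hr => lt_of_lt_of_le ha hr.1
  have cf : Continuous (mode u p) := mode_continuous hu.1.continuous p
  have cf' : Continuous (mode1 u p) := continuous_iff_continuousAt.2 fun r => (mode1_deriv hu.1 p r).continuousAt
  have cf'' := mode2_continuous hu.1 p
  have ch : Continuous (mode (lap u) p) := mode_continuous (lap_continuous hu.1) p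
  have cL : ContinuousOn (Lop n k (mode u p) (mode1 u p) (mode2 u p)) (Icc a b) := by
    unfold Lop
    refine ContinuousOn.sub (ContinuousOn.add (by fun_prop) (ContinuousOn.mul ?_ (by fun_prop)))
      (ContinuousOn.mul ?_ (by fun_prop))
    · exact continuousOn_const.div continuousOn_id fun r hr => (hpos r hr).ne'
    · exact continuousOn_const.div (continuousOn_id.pow 2) fun r hr => pow_ne_zero 2 (hpos r hr).ne'
  set w : ℝ → ℝ := fun r => r ^ (n-1+k) * (mode (lap u) p r - Lop n k (mode u p) (mode1 u p) (mode2 u p) r) with hw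
  have cw : ContinuousOn w (Icc a b) := by
    refine ContinuousOn.mul (by fun_prop) (ch.continuousOn.sub cL)
  have hae : ∀ᵐ x ∂(volume : Measure ℝ), x ∈ Ioo a b → w x = 0 := by
    refine isOpen_Ioo.ae_eq_zero_of_integral_contDiff_smul_eq_zero ?_ ?_
    · exact (cw.mono Ioo_subset_Icc_self).locallyIntegrableOn measurableSet_Ioo
    · intro g hg hgc hgs
      have hg0 : ∀ r, r ∉ Ioo a b → g r = 0 := fun r hr =>
        image_eq_zero_of_notMem_tsupport fun h => hr (hgs h)
      have hψ := contDiff_sqrt_comp (hg.of_le (by norm_cast)) ha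
        (fun r hr => hg0 r fun h => absurd h.1 (not_lt.2 hr.le))
      have e1 := mode_weak hn hu hp ha hab hs hψ
      have e2 := mode_weak2 hn (k := k) (mode_deriv hu.1 p) (mode1_deriv hu.1 p) cf'' ha hab za.1 zb.1 za.2 zb.2 hψ
      have i1 : IntervalIntegrable (fun r => r ^ (n - 1 + k) * g (Real.sqrt (r^2)) * mode (lap u) p r) volume a b := by
        apply Continuous.intervalIntegrable
        have := hψ.continuous
        have h3 : Continuous fun r : ℝ => g (Real.sqrt (r^2)) := hg.continuous.comp (by fun_prop)
        exact ((continuous_pow _).mul h3).mul ch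
      have i2 : IntervalIntegrable (fun r => r ^ (n - 1 + k) * g (Real.sqrt (r^2)) *
          Lop n k (mode u p) (mode1 u p) (mode2 u p) r) volume a b := by
        apply ContinuousOn.intervalIntegrable
        rw [uIcc_of_le hab.le]
        have h3 : Continuous fun r : ℝ => g (Real.sqrt (r^2)) := hg.continuous.comp (by fun_prop)
        exact ((continuous_pow _).mul h3).continuousOn.mul cL
      have i3 : IntervalIntegrable (fun r => r ^ (n - 1 + k) * mode u p r *
        (4 * r^2 * deriv (deriv fun t => g (Real.sqrt t)) (r^2) +
          (2*n+4*k) * deriv (fun t => g (Real.sqrt t)) (r^2))) volume a b := by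
        apply Continuous.intervalIntegrable
        have hψ1 : ContDiff ℝ 1 (deriv fun t => g (Real.sqrt t)) := by
          have : ContDiff ℝ (1+1) fun t => g (Real.sqrt t) := by simpa [one_add_one_eq_two] using hψ
          exact (contDiff_succ_iff_deriv.1 this).2.2
        have hc1 := hψ1.continuous
        have hc2 : Continuous (deriv (deriv fun t => g (Real.sqrt t))) := hψ1.continuous_deriv (by norm_num)
        fun_prop
      rw [intervalIntegral.integral_sub i3 i2, ← e1, ← intervalIntegral.integral_sub i1 i2] at e2
      rw [← e2, intervalIntegral.integral_of_le hab.le]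
      rw [← setIntegral_eq_integral_of_forall_compl_eq_zero (s := Ioc a b)]
      · refine setIntegral_congr_fun measurableSet_Ioc fun r hr => ?_
        simp only [hw, Real.sqrt_sq (hpos r ⟨hr.1.le, hr.2⟩).le, smul_eq_mul]
        ring
      · intro r hr
        rw [hg0 r fun h => hr ⟨h.1, h.2.le⟩, zero_smul]
  have h2 := Measure.eqOn_Icc_of_ae_eq (μ := (volume : Measure ℝ)) hab.ne (f := w) (g := fun _ => 0) ?_ cw continuousOn_const
  · have := h2 hr
    simp only [hw, mul_eq_zero] at this
    rcases this with h | h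
    · exact absurd h (pow_ne_zero _ (hpos r hr).ne')
    · linarith
  · rw [Measure.restrict_congr_set Ioo_ae_eq_Icc.symm]
    exact (ae_restrict_iff' measurableSet_Ioo).2 hae

end Modes

/-! ### Part 5: one-dimensional Hardy inequalities -/

section OneDim
variable {n : ℕ}

lemma hardy1 {g g' : ℝ → ℝ} {a b : ℝ} (ha : 0 < a) (hab : a < b) (hg : ∀ r, HasDerivAt g (g' r) r)
    (hg' : Continuous g') (ga : g a = 0) (gb : g b = 0) (β κ : ℝ) :
    (κ + β/2)^2 * ∫ r in a..b, r ^ (β - 1) * (g r)^2 ≤ ∫ r in a..b, r ^ (β-1) * (r * g' r - κ * g r)^2 := by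
  have cg : Continuous g := continuous_iff_continuousAt.2 fun r => (hg r).continuousAt
  have hpos : ∀ r ∈ uIcc a b, 0 < r := by
    intro r hr
    rw [uIcc_of_le hab.le] at hr
    exact lt_of_lt_of_le ha hr.1
  have crp : ContinuousOn (fun r : ℝ => r ^ (β-1)) (uIcc a b) := fun r hr =>
    (Real.continuousAt_rpow_const _ _ (Or.inl (hpos r hr).ne')).continuousWithinAt
  have key := intervalIntegral.integral_eq_sub_of_hasDerivAt
    (f := fun r => r ^ β * (g r)^2)
    (f' := fun r => r ^ (β-1) * (2 * g r * (r * g' r + β/2 * g r))) (a := a) (b := b) ?_ ?_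
  · simp only [ga, gb] at key
    norm_num at key
    have h1 : ∫ r in a..b, r ^ (β-1) * (r * g' r - κ * g r)^2 =
      (∫ r in a..b, r ^ (β-1) * (r * g' r + β/2 * g r)^2) 
        - (κ + β/2) * (∫ r in a..b, r ^ (β-1) * (2 * g r * (r * g' r + β/2 * g r)))
        + (κ + β/2)^2 * ∫ r in a..b, r ^ (β - 1) * (g r)^2 := by
      rw [← intervalIntegral.integral_const_mul, ← intervalIntegral.integral_const_mul,
        ← intervalIntegral.integral_sub, ← intervalIntegral.integral_add]
      · congr 1; ext r; ring
      · exact (ContinuousOn.sub (by fun_prop) (by fun_prop)).intervalIntegrable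
      · exact ContinuousOn.intervalIntegrable (by fun_prop)
      · exact ContinuousOn.intervalIntegrable (by fun_prop)
      · exact ContinuousOn.intervalIntegrable (by fun_prop)
    rw [h1, key]
    have : 0 ≤ ∫ r in a..b, r ^ (β-1) * (r * g' r + β/2 * g r)^2 := by
      apply intervalIntegral.integral_nonneg hab.le
      intro r hr
      have := ha.le.trans hr.1
      positivity
    linarith
  · intro r hr
    have hr0 := hpos r hr
    have h := (Real.hasDerivAt_rpow_const (p := β) (Or.inl hr0.ne')).fun_mul ((hg r).fun_pow 2)
    refine h.congr_deriv ?_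
    have : r ^ β = r ^ (β-1) * r := by rw [← Real.rpow_add_one hr0.ne']; ring_nf
    rw [this]; push_cast; ring
  · exact ContinuousOn.intervalIntegrable (by fun_prop)

lemma hardy2 {f f' f'' : ℝ → ℝ} {a b : ℝ} (ha : 0 < a) (hab : a < b) (hf : ∀ r, HasDerivAt f (f' r) r)
    (hf' : ∀ r, HasDerivAt f' (f'' r) r) (hf'' : Continuous f'')
    (fa : f a = 0) (fb : f b = 0) (fa' : f' a = 0) (fb' : f' b = 0) (β : ℝ) (k : ℕ) :
    ((k + β/2) * (-(k + n - 2) + β/2))^2 * ∫ r in a..b, r ^ (β - 1) * (f r)^2 ≤ 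
      ∫ r in a..b, r ^ (β-1) * (r^2 * Lop n k f f' f'' r)^2 := by
  have cf : Continuous f := continuous_iff_continuousAt.2 fun r => (hf r).continuousAt
  have cf' : Continuous f' := continuous_iff_continuousAt.2 fun r => (hf' r).continuousAt
  have h1 := hardy1 ha hab hf cf' fa fb β (-(k+n-2))
  have hg : ∀ r, HasDerivAt (fun r => r * f' r + (k + n - 2) * f r)
      (f' r + r * f'' r + (k+n-2) * f' r) r := by
    intro r
    have := ((hasDerivAt_id r).fun_mul (hf' r)).fun_add ((hf r).const_mul ((k:ℝ)+n-2))
    refine this.congr_deriv ?_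
    simp
  have h2 := hardy1 ha hab hg (by fun_prop) (by simp [fa, fa']) (by simp [fb, fb']) β k
  have e1 : ∫ r in a..b, r ^ (β-1) * (r^2 * Lop n k f f' f'' r)^2 =
     ∫ r in a..b, r ^ (β-1) * (r * (f' r + r * f'' r + (k+n-2) * f' r) - k * (r * f' r + (k + n - 2) * f r))^2 := by
    refine intervalIntegral.integral_congr fun r hr => ?_
    rw [uIcc_of_le hab.le] at hr
    have hr0 : r ≠ 0 := (ha.trans_le hr.1).ne'
    have : r^2 * Lop n k f f' f'' r = 
      (r * (f' r + r * f'' r + (k+n-2) * f' r) - k * (r * f' r + (k + n - 2) * f r)) := by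
      simp only [Lop]; field_simp; ring
    simp only [this]
  have e2 : ∀ r, r * f' r - -((k:ℝ)+n-2) * f r = r * f' r + (k + n - 2) * f r := fun r => by ring
  simp only [e2] at h1
  rw [e1, mul_pow, mul_assoc]
  exact (mul_le_mul_of_nonneg_left h1 (sq_nonneg _)).trans h2

lemma mode_ineq (hn : 2 ≤ n) {u : EuclideanSpace ℝ (Fin n) → ℝ} (hu : DirichletAdm {0}ᶜ u)
    {k : ℕ} {p : MvPolynomial (Fin n) ℝ} (hp : p ∈ Harm n k) {a b : ℝ} (ha : 0 < a) (hab : a < b)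
    (hs : ∀ x ∈ tsupport u, a < ‖x‖ ∧ ‖x‖ < b) (α : ℝ) :
    ((k + (α + n - 4)/2) * ((α - n)/2 - k))^2 * ∫ r in a..b, r ^ (n-1) * (r ^ (α - 4) * (mode u p r)^2) ≤ 
      ∫ r in a..b, r ^ (n-1) * (r ^ α * (mode (lap u) p r)^2) := by
  have za := mode_zero p ha.le (fun x hx => (hs x hx).1.ne')
  have zb := mode_zero p (ha.trans hab).le (fun x hx => (hs x hx).2.ne)
  have h := hardy2 (n := n) ha hab (mode_deriv hu.1 p) (mode1_deriv hu.1 p) (mode2_continuous hu.1 p)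
    za.1 zb.1 za.2 zb.2 (α + n - 4) k
  have e0 : -((k:ℝ) + n - 2) + (α + n - 4)/2 = (α - n)/2 - k := by ring
  rw [e0] at h
  have pw : ∀ r : ℝ, 0 < r → r ^ (α + n - 4 - 1) = r ^ (n-1) * r ^ (α - 4) := by
    intro r hr
    rw [← Real.rpow_natCast, ← Real.rpow_add hr]
    congr 1
    push_cast [Nat.cast_sub (by omega : 1 ≤ n)]; ring
  have i1 : ∫ r in a..b, r ^ (n-1) * (r ^ (α - 4) * (mode u p r)^2) =
      ∫ r in a..b, r ^ (α + n - 4 - 1) * (mode u p r)^2 := by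
    refine intervalIntegral.integral_congr fun r hr => ?_
    rw [uIcc_of_le hab.le] at hr
    simp only [pw r (ha.trans_le hr.1)]
    ring
  have i2 : ∫ r in a..b, r ^ (n-1) * (r ^ α * (mode (lap u) p r)^2) =
      ∫ r in a..b, r ^ (α + n - 4 - 1) * (r^2 * Lop n k (mode u p) (mode1 u p) (mode2 u p) r)^2 := by
    refine intervalIntegral.integral_congr fun r hr => ?_
    rw [uIcc_of_le hab.le] at hr
    have hr0 := ha.trans_le hr.1
    have e4 : r ^ α = r ^ (α - 4) * r ^ 4 := by
      rw [← Real.rpow_natCast r 4, ← Real.rpow_add hr0]; congr 1; push_cast; ring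
    simp only [pw r hr0, mode_ode hn hu hp ha hab hs hr, e4]
    ring
  rw [i1, i2]
  exact h

/-- uniform lower bound for non-exceptional exponents -/
lemma dist_nat_pos (c : ℝ) (h : ∀ k : ℕ, c ≠ k) : ∃ δ > 0, ∀ k : ℕ, δ ≤ (c - k)^2 := by
  by_cases hc : c < 0
  · exact ⟨c^2, by nlinarith, fun k => by have : (0:ℝ) ≤ k := k.cast_nonneg; nlinarith⟩
  push Not at hc
  have h1 : (⌊c⌋₊ : ℝ) < c := lt_of_le_of_ne (Nat.floor_le hc) (h _).symm
  have h2 := Nat.lt_floor_add_one c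
  set m := ⌊c⌋₊
  refine ⟨min ((c - m)^2) ((m + 1 - c)^2), ?_, fun k => ?_⟩
  · have := sub_pos.2 h1; have := sub_pos.2 h2; positivity
  · rcases le_or_gt k m with hk | hk
    · refine (min_le_left _ _).trans ?_
      have : (k:ℝ) ≤ m := by exact_mod_cast hk
      nlinarith
    · refine (min_le_right _ _).trans ?_
      have : (m:ℝ) + 1 ≤ k := by exact_mod_cast hk
      nlinarith

lemma unif_bound {α : ℝ} (h1 : ∀ k : ℕ, α ≠ n + 2 * k) (h2 : ∀ k : ℕ, α ≠ 4 - n - 2 * k) :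
    ∃ c > 0, ∀ k : ℕ, c ≤ ((k + (α + n - 4)/2) * ((α - n)/2 - k))^2 := by
  obtain ⟨d1, hd1, H1⟩ := dist_nat_pos ((α - n)/2) (fun k hk => h1 k (by linarith))
  obtain ⟨d2, hd2, H2⟩ := dist_nat_pos (-(α + n - 4)/2) (fun k hk => h2 k (by linarith))
  refine ⟨d2 * d1, by positivity, fun k => ?_⟩
  rw [mul_pow]
  have := H2 k
  refine mul_le_mul (this.trans (le_of_eq (by ring))) (H1 k) hd1.le (sq_nonneg _)

end OneDim

/-! ### Part 6: orthogonality and completeness of spherical harmonics -/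

section Harmonics
variable {n : ℕ}

lemma rad_supp {φ : ℝ → ℝ} {A B : ℝ} (hA : ∀ t ≤ A, φ t = 0)
    (hB : ∀ t, B ≤ t → φ t = 0) (p : MvPolynomial (Fin n) ℝ) :
    tsupport (fun y : EuclideanSpace ℝ (Fin n) => φ (‖y‖^2) * ev p y) ⊆ {y | A ≤ ‖y‖^2 ∧ ‖y‖^2 ≤ B} := by
  refine closure_minimal ?_ ?_
  · intro y hy
    by_contra h
    simp only [mem_setOf_eq, not_and_or, not_le] at h
    rcases h with h | h
    · exact hy (by simp [hA _ h.le])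
    · exact hy (by simp [hB _ h.le])
  · have hc : Continuous fun y : EuclideanSpace ℝ (Fin n) => ‖y‖^2 := by fun_prop
    exact (isClosed_le continuous_const hc).inter (isClosed_le hc continuous_const)

lemma rad_adm {φ : ℝ → ℝ} (hφ : ContDiff ℝ 2 φ) {A B : ℝ} (hA0 : 0 < A) (hA : ∀ t ≤ A, φ t = 0)
    (hB : ∀ t, B ≤ t → φ t = 0) (p : MvPolynomial (Fin n) ℝ) :
    DirichletAdm {(0 : EuclideanSpace ℝ (Fin n))}ᶜ (fun y => φ (‖y‖^2) * ev p y) := by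
  have hs := rad_supp hA hB p
  refine ⟨(hφ.comp (contDiff_norm_sq ℝ)).mul (ev_contDiff p), ?_, ?_⟩
  · refine HasCompactSupport.of_support_subset_isCompact (isCompact_closedBall 0 (Real.sqrt B)) ?_
    intro y hy
    have := (hs (subset_tsupport _ hy)).2
    simp only [mem_closedBall, dist_zero_right]
    exact Real.le_sqrt_of_sq_le this
  · intro y hy h0
    rw [mem_singleton_iff] at h0
    have := (hs hy).1
    rw [h0] at this
    simp at this
    linarith

lemma harm_orth (hn : 2 ≤ n) {k l : ℕ} (hkl : k ≠ l) {p q : MvPolynomial (Fin n) ℝ}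
    (hp : p ∈ Harm n k) (hq : q ∈ Harm n l) :
    ∫ σ : sphere (0 : EuclideanSpace ℝ (Fin n)) 1, ev q σ.1 * ev p σ.1 ∂(sig n) = 0 := by
  let ψ : ContDiffBump (1:ℝ) := ⟨1/4, 1/2, by norm_num, by norm_num⟩
  have h1 : ∀ t ∈ ball (1:ℝ) (1/4), ψ t = 1 := fun t ht => ψ.one_of_mem_closedBall (ball_subset_closedBall ht)
  have h0 : ∀ t, 1/2 ≤ |t - 1| → ψ t = 0 := fun t ht => ψ.zero_of_le_dist (by rw [Real.dist_eq]; exact ht)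
  have hA : ∀ t ≤ (1/2:ℝ), ψ t = 0 := fun t ht => h0 t (by rw [abs_of_neg (by linarith)]; linarith)
  have hB : ∀ t, (3/2:ℝ) ≤ t → ψ t = 0 := fun t ht => h0 t (by rw [abs_of_pos (by linarith)]; linarith)
  have hψ : ContDiff ℝ 2 ψ := ψ.contDiff
  have hu := rad_adm (n := n) hψ (by norm_num) hA hB q
  set u : EuclideanSpace ℝ (Fin n) → ℝ := fun y => ψ (‖y‖^2) * ev q y with hudef
  have hs : ∀ x ∈ tsupport u, (1/2 : ℝ) < ‖x‖ ∧ ‖x‖ < 2 := by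
    intro x hx
    have := rad_supp hA hB q hx
    have h3 := norm_nonneg x
    constructor <;> nlinarith [this.1, this.2]
  have ode := mode_ode hn hu hp (by norm_num) (by norm_num) hs (r := 1) (by norm_num)
  set c := ∫ σ : sphere (0 : EuclideanSpace ℝ (Fin n)) 1, ev q σ.1 * ev p σ.1 ∂(sig n) with hc
  have hm : ∀ᶠ r in nhds (1:ℝ), 0 < r ∧ mode u p r = c * r ^ l := by
    have e1 : ∀ᶠ r in nhds (1:ℝ), r^2 ∈ ball (1:ℝ) (1/4) := by
      have : ContinuousAt (fun r : ℝ => r^2) 1 := by fun_prop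
      exact this.eventually_mem (isOpen_ball.mem_nhds (by simp))
    filter_upwards [e1, eventually_gt_nhds one_pos] with r hr hr0
    refine ⟨hr0, ?_⟩
    rw [hc, mul_comm, ← integral_const_mul, mode]
    congr 1; ext σ
    simp only [hudef, sph_norm hr0.le, h1 _ hr, ev_smul (mem_Harm.1 hq).1]
    ring
  have hm1 : ∀ᶠ r in nhds (1:ℝ), mode1 u p r = c * (l * r ^ l / r) := by
    filter_upwards [hm.eventually_nhds] with r hr
    have hr0 := hr.self_of_nhds.1
    have := ((hasDerivAt_pow_div l hr0.ne').const_mul c).congr_of_eventuallyEq (hr.mono fun s hs => hs.2)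
    exact (mode_deriv hu.1 p r).unique this
  have hm2 : mode2 u p 1 = c * (l * (l - 1)) := by
    have hd : HasDerivAt (fun r : ℝ => c * (l * r ^ l / r)) (c * (l * (l - 1))) 1 := by
      have := ((((hasDerivAt_pow_div l one_ne_zero).const_mul (l:ℝ)).fun_div (hasDerivAt_id (1:ℝ)) one_ne_zero).const_mul c)
      refine this.congr_deriv ?_
      simp; left; ring
    exact (mode1_deriv hu.1 p 1).unique (hd.congr_of_eventuallyEq hm1)
  have hz : mode (lap u) p 1 = 0 := by
    have : ∀ σ : sphere (0 : EuclideanSpace ℝ (Fin n)) 1, lap u ((1:ℝ) • σ.1) = 0 := by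
      intro σ
      rw [hudef, lap_radial_mul hq hψ.contDiffAt, sph_norm zero_le_one]
      have e1 : (ψ : ℝ → ℝ) =ᶠ[nhds 1] fun _ => 1 := by
        filter_upwards [isOpen_ball.mem_nhds (mem_ball_self (x := (1:ℝ)) (by norm_num : (0:ℝ) < 1/4))] with t ht using h1 t ht
      have e2 : deriv ψ =ᶠ[nhds 1] fun _ => 0 := by
        have := e1.deriv
        simpa using this
      have e3 : deriv (deriv ψ) 1 = 0 := by rw [e2.deriv_eq]; simp
      have e4 : deriv ψ 1 = 0 := e2.self_of_nhds
      simp [e3, e4]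
    simp only [mode, this]
    simp
  rw [hz, Lop, hm2, hm1.self_of_nhds, hm.self_of_nhds.2] at ode
  simp only [one_pow, div_one, mul_one] at ode
  have hf : c * (((l:ℝ) - k) * (l + k + n - 2)) = 0 := by linear_combination -ode
  rcases mul_eq_zero.1 hf with h | h
  · exact h
  · exfalso
    rcases mul_eq_zero.1 h with h | h
    · exact hkl (by have : (l:ℝ) = k := by linarith
                    exact_mod_cast this.symm)
    · have hn' : (2:ℝ) ≤ n := by exact_mod_cast hn
      have : (1:ℝ) ≤ l + k := by exact_mod_cast (by omega : 1 ≤ l + k)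
      linarith

/-- restriction of polynomials to the sphere -/
def evS (n : ℕ) : MvPolynomial (Fin n) ℝ →ₐ[ℝ] C(sphere (0 : EuclideanSpace ℝ (Fin n)) 1, ℝ) :=
  MvPolynomial.aeval fun i => ⟨fun σ => σ.1 i, by fun_prop⟩

lemma evS_apply (p : MvPolynomial (Fin n) ℝ) (σ : sphere (0 : EuclideanSpace ℝ (Fin n)) 1) :
    evS n p σ = ev p σ.1 := by
  induction p using MvPolynomial.induction_on with
  | C a => simp [evS, ev]
  | add p q hp hq => rw [map_add, ContinuousMap.add_apply, hp, hq, ev_add]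
  | mul_X p i hp => rw [map_mul, ContinuousMap.mul_apply, hp, ev_mul, ev_X]; simp [evS]

def evL (n : ℕ) : MvPolynomial (Fin n) ℝ →ₗ[ℝ] Lp ℝ 2 (sig n) :=
  (ContinuousMap.toLp 2 (sig n) ℝ).toLinearMap ∘ₗ (evS n).toLinearMap

lemma evL_apply (p : MvPolynomial (Fin n) ℝ) : evL n p = ContinuousMap.toLp 2 (sig n) ℝ (evS n p) := rfl

lemma evS_rsq : evS n (rsq n) = 1 := by
  ext σ
  rw [evS_apply, ContinuousMap.one_apply]
  have : ‖σ.1‖ ^ 2 = 1 := by rw [norm_eq_of_mem_sphere]; norm_num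
  rw [EuclideanSpace.real_norm_sq_eq] at this
  simpa [ev, rsq] using this

lemma evL_dense (hn : 2 ≤ n) (W : Submodule ℝ (Lp ℝ 2 (sig n)))
    (hW : ∀ k, ∀ p ∈ Harm n k, evL n p ∈ W) : W.topologicalClosure = ⊤ := by
  have hall : ∀ p, evL n p ∈ W := by
    intro p
    have hF : ∀ m, ∀ q ∈ Fis n m, evL n q ∈ W := by
      intro m
      suffices Fis n m ≤ W.comap (evL n) from this
      rw [Fis, Submodule.span_le]
      rintro _ ⟨j, d, h, hh, -, rfl⟩
      have : evL n (rsq n ^ j * h) = evL n h := by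
        rw [evL_apply, map_mul, map_pow, evS_rsq, one_pow, one_mul, evL_apply]
      show evL n (rsq n ^ j * h) ∈ W
      rw [this]; exact hW d h hh
    rw [← MvPolynomial.sum_homogeneousComponent p, map_sum]
    exact Submodule.sum_mem _ fun i _ => hF i _ (mem_Fis (by omega) i _
      (MvPolynomial.homogeneousComponent_isHomogeneous i p))
  have hA : (evS n).range.topologicalClosure = ⊤ := by
    apply ContinuousMap.subalgebra_topologicalClosure_eq_top_of_separatesPoints
    intro x y hxy
    have : ∃ i, x.1 i ≠ y.1 i := by
      by_contra h
      push Not at h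
      exact hxy (Subtype.ext (by ext i; exact h i))
    obtain ⟨i, hi⟩ := this
    refine ⟨_, ⟨evS n (MvPolynomial.X i), ⟨_, rfl⟩, rfl⟩, ?_⟩
    simpa [evS_apply, ev_X] using hi
  have hA' : (Subalgebra.toSubmodule (evS n).range).topologicalClosure = ⊤ :=
    congr_arg Subalgebra.toSubmodule hA
  have := (ContinuousMap.toLp_denseRange ℝ (sig n) ℝ (p := 2) (by norm_num)).topologicalClosure_map_submodule hA'
  rw [eq_top_iff, ← this]
  apply Submodule.topologicalClosure_mono
  rintro _ ⟨_, ⟨p, rfl⟩, rfl⟩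
  exact hall p

lemma exists_harm_basis (hn : 2 ≤ n) : ∃ (ι : Type) (_ : Countable ι) (deg : ι → ℕ)
    (P : ι → MvPolynomial (Fin n) ℝ), (∀ i, P i ∈ Harm n (deg i)) ∧
    ∀ f : C(sphere (0 : EuclideanSpace ℝ (Fin n)) 1, ℝ),
      HasSum (fun i => (∫ σ, f σ * ev (P i) σ.1 ∂(sig n))^2) (∫ σ, (f σ)^2 ∂(sig n)) := by
  let V : ℕ → Submodule ℝ (Lp ℝ 2 (sig n)) := fun k => (Harm n k).map (evL n)
  have hfd : ∀ k, FiniteDimensional ℝ (V k) := fun k => inferInstance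
  have hV : OrthogonalFamily ℝ (fun k => V k) (fun k => (V k).subtypeₗᵢ) := by
    rw [OrthogonalFamily]
    intro k l hkl
    rintro ⟨_, p, hp, rfl⟩ ⟨_, q, hq, rfl⟩
    simp only [Submodule.coe_subtypeₗᵢ, Submodule.subtype_apply]
    rw [evL_apply, evL_apply, ContinuousMap.inner_toLp]
    simpa [evS_apply] using harm_orth hn hkl hp hq
  let B := fun k => stdOrthonormalBasis ℝ (V k)
  have hB := hV.orthonormal_sigma_orthonormal (fun k => (B k).orthonormal)
  have hmem : ∀ i : (Σ k, Fin (Module.finrank ℝ (V k))), ∃ p ∈ Harm n i.1, evL n p = (B i.1 i.2 : Lp ℝ 2 (sig n)) :=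
    fun i => (B i.1 i.2).2
  choose P hP hPe using hmem
  have hd := evL_dense hn (Submodule.span ℝ (Set.range fun a : (Σ k, Fin (Module.finrank ℝ (V k))) => 
    (V a.1).subtypeₗᵢ (B a.1 a.2))) (by
      intro k p hp
      have h1 : (⟨evL n p, ⟨p, hp, rfl⟩⟩ : V k) ∈ Submodule.span ℝ (Set.range (B k)) := by
        rw [← OrthonormalBasis.coe_toBasis, (B k).toBasis.span_eq]; trivial
      have h2 := Submodule.mem_map_of_mem (f := (V k).subtype) h1
      rw [Submodule.map_span] at h2
      refine Submodule.span_mono ?_ h2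
      rintro _ ⟨_, ⟨i, rfl⟩, rfl⟩
      exact ⟨⟨k, i⟩, rfl⟩)
  let hb := HilbertBasis.mk hB hd.ge
  refine ⟨_, inferInstance, fun i => i.1, P, hP, fun f => ?_⟩
  have := hb.hasSum_inner_mul_inner (ContinuousMap.toLp 2 (sig n) ℝ f) (ContinuousMap.toLp 2 (sig n) ℝ f)
  have he : ∀ i, hb i = ContinuousMap.toLp 2 (sig n) ℝ (evS n (P i)) := by
    intro i
    rw [← evL_apply, hPe, HilbertBasis.coe_mk]; rfl
  simp only [he, ContinuousMap.inner_toLp, evS_apply] at this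
  have e1 : ∀ i, ∫ x : sphere (0 : EuclideanSpace ℝ (Fin n)) 1, ev (P i) x.1 * f x ∂(sig n) =
      ∫ x, f x * ev (P i) x.1 ∂(sig n) := fun i => by
    congr 1; ext x; rw [mul_comm]
  simp only [conj_trivial, e1, ← sq] at this
  exact this

end Harmonics

/-! ### Part 7: the Rellich inequality for non-exceptional exponents -/

section Rellich
variable {n : ℕ}

lemma weight_cont {v : EuclideanSpace ℝ (Fin n) → ℝ} (hv : Continuous v) {a b : ℝ} (ha : 0 < a)
    (hs : ∀ x, v x ≠ 0 → a ≤ ‖x‖ ∧ ‖x‖ ≤ b) (γ : ℝ) : Continuous fun x => ‖x‖ ^ γ * (v x)^2 := by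
  refine continuous_weight (hv.pow 2) fun h => ?_
  have : tsupport (fun x => v x ^ 2) ⊆ {x | a ≤ ‖x‖} := by
    refine closure_minimal ?_ (isClosed_le continuous_const continuous_norm)
    intro x hx
    exact (hs x fun h => hx (by simp [h])).1
  have := this h
  simp at this
  linarith

lemma polar_parseval (hn : 2 ≤ n) {ι : Type} [Countable ι] {P : ι → MvPolynomial (Fin n) ℝ}
    (hP : ∀ f : C(sphere (0 : EuclideanSpace ℝ (Fin n)) 1, ℝ),
      HasSum (fun i => (∫ σ, f σ * ev (P i) σ.1 ∂(sig n))^2) (∫ σ, (f σ)^2 ∂(sig n)))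
    {v : EuclideanSpace ℝ (Fin n) → ℝ} (hv : Continuous v) {a b : ℝ} (ha : 0 < a) (hab : a < b)
    (hs : ∀ x, v x ≠ 0 → a ≤ ‖x‖ ∧ ‖x‖ ≤ b) (γ : ℝ) :
    HasSum (fun i => ∫ r in a..b, r ^ (n-1) * (r ^ γ * (mode v (P i) r)^2))
      (∫ x, ‖x‖ ^ γ * (v x)^2) := by
  rw [polar_ab hn (weight_cont hv ha hs γ) ha hab.le (fun x hx => hs x fun h => hx (by simp [h]))]
  have hpar : ∀ r : ℝ, 0 < r → HasSum (fun i => r ^ (n-1) * (r ^ γ * (mode v (P i) r)^2))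
      (r ^ (n-1) * ∫ σ : sphere (0 : EuclideanSpace ℝ (Fin n)) 1, ‖r • σ.1‖ ^ γ * (v (r • σ.1))^2 ∂(sig n)) := by
    intro r hr
    have := ((hP ⟨fun σ => v (r • σ.1), by fun_prop⟩).mul_left (r ^ γ)).mul_left (r ^ (n-1))
    simp only [sph_norm hr.le, integral_const_mul]
    exact this
  have hpos : ∀ r ∈ uIcc a b, 0 < r := by
    intro r hr
    rw [uIcc_of_le hab.le] at hr
    exact ha.trans_le hr.1
  have hpos' : ∀ r ∈ uIoc a b, 0 < r := fun r hr => hpos r (uIoc_subset_uIcc hr)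
  have crp : ContinuousOn (fun r : ℝ => r ^ γ) (uIcc a b) := fun r hr =>
    (Real.continuousAt_rpow_const _ _ (Or.inl (hpos r hr).ne')).continuousWithinAt
  refine intervalIntegral.hasSum_integral_of_dominated_convergence
    (fun i r => r ^ (n-1) * (r ^ γ * (mode v (P i) r)^2)) ?_ ?_ ?_ ?_ ?_
  · intro i
    have cm := mode_continuous hv (P i)
    have : ContinuousOn (fun r : ℝ => r ^ (n-1) * (r ^ γ * (mode v (P i) r)^2)) (uIcc a b) := by fun_prop
    exact (this.mono uIoc_subset_uIcc).aestronglyMeasurable measurableSet_uIoc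
  · refine fun i => Eventually.of_forall fun r hr => ?_
    have := hpos' r hr
    rw [Real.norm_of_nonneg (by positivity)]
  · exact Eventually.of_forall fun r hr => (hpar r (hpos' r hr)).summable
  · have cc : ContinuousOn (fun r : ℝ => r ^ (n-1) * (r ^ γ *
      ∫ σ : sphere (0 : EuclideanSpace ℝ (Fin n)) 1, (v (r • σ.1))^2 ∂(sig n))) (uIcc a b) := by
      have : Continuous fun r : ℝ => ∫ σ : sphere (0 : EuclideanSpace ℝ (Fin n)) 1, (v (r • σ.1))^2 ∂(sig n) :=
        sph_continuous (F := fun r σ => (v (r • σ.1))^2) (by fun_prop)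
      exact (continuous_pow _).continuousOn.mul (crp.mul this.continuousOn)
    refine cc.intervalIntegrable.congr fun r hr => ?_
    rw [(hpar r (hpos' r hr)).tsum_eq]
    simp only [sph_norm (hpos' r hr).le, integral_const_mul]
  · exact Eventually.of_forall fun r hr => hpar r (hpos' r hr)

lemma rellich_ineq (hn : 2 ≤ n) {α c : ℝ}
    (hc : ∀ k : ℕ, c ≤ ((k + (α + n - 4)/2) * ((α - n)/2 - k))^2)
    {u : EuclideanSpace ℝ (Fin n) → ℝ} (hu : DirichletAdm {0}ᶜ u) :
    c * ∫ x, ‖x‖ ^ (α - 4) * (u x)^2 ≤ ∫ x, ‖x‖ ^ α * (lap u x)^2 := by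
  obtain ⟨a, b, ha, hab, hs⟩ := adm_annulus hu
  obtain ⟨ι, _, deg, P, hPh, hP⟩ := exists_harm_basis hn
  have s1 := polar_parseval hn hP hu.1.continuous ha hab (fun x hx => by
    have := hs x (subset_tsupport _ hx); exact ⟨this.1.le, this.2.le⟩) (α - 4)
  have s2 := polar_parseval hn hP (lap_continuous hu.1) ha hab (fun x hx => by
    have := hs x (by by_contra h; exact hx (lap_zero_of h)); exact ⟨this.1.le, this.2.le⟩) α
  refine hasSum_le (fun i => ?_) (s1.mul_left c) s2
  refine le_trans ?_ (mode_ineq hn hu (hPh i) ha hab hs α)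
  refine mul_le_mul_of_nonneg_right (hc _) ?_
  apply intervalIntegral.integral_nonneg hab.le
  intro r hr
  have := ha.trans_le hr.1
  positivity

lemma denom_pos {α : ℝ} {u : EuclideanSpace ℝ (Fin n) → ℝ} (hu : DirichletAdm {0}ᶜ u)
    (h0 : ∃ x, u x ≠ 0) : 0 < ∫ x, ‖x‖ ^ α * (u x)^2 := by
  obtain ⟨a, b, ha, hab, hs⟩ := adm_annulus hu
  obtain ⟨x, hx⟩ := h0
  have hx0 := (hs x (subset_tsupport _ hx)).1
  refine (weight_cont hu.1.continuous ha (fun x hx => by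
    have := hs x (subset_tsupport _ hx); exact ⟨this.1.le, this.2.le⟩) α).integral_pos_of_hasCompactSupport_nonneg_nonzero
    (x := x) ?_ ?_ ?_
  · refine hu.2.1.mono' ?_
    intro y hy
    exact subset_tsupport _ fun h => hy (by simp [h])
  · intro y; positivity
  · have : 0 < ‖x‖ := by linarith
    positivity

lemma ratio_nonneg {α : ℝ} : ∀ q ∈ RellichRatioSet n α, 0 ≤ q := by
  rintro q ⟨u, -, -, rfl⟩
  refine div_nonneg (integral_nonneg fun x => ?_) (integral_nonneg fun x => ?_) <;> positivity

lemma rellich_pos (hn : 2 ≤ n) {α : ℝ} (hne : (RellichRatioSet n α).Nonempty)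
    (h1 : ∀ k : ℕ, α ≠ n + 2 * k) (h2 : ∀ k : ℕ, α ≠ 4 - n - 2 * k) :
    0 < sInf (RellichRatioSet n α) := by
  obtain ⟨c, hc, H⟩ := unif_bound h1 h2
  refine hc.trans_le (le_csInf hne ?_)
  rintro q ⟨u, hu, hx, rfl⟩
  rw [le_div_iff₀ (denom_pos hu hx)]
  exact rellich_ineq hn H hu

end Rellich

/-! ### Part 8: minimizing sequences for exceptional exponents -/

section Sharp
variable {n : ℕ}

def phi (χ : ℝ → ℝ) (s δ t : ℝ) : ℝ := if t ≤ 0 then 0 else t ^ s * χ (δ * Real.log t)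

lemma phi_pos (χ : ℝ → ℝ) (s δ : ℝ) {t : ℝ} (ht : 0 < t) : phi χ s δ t = t ^ s * χ (δ * Real.log t) := by
  rw [phi, if_neg (not_le.2 ht)]

lemma phi_ev (χ : ℝ → ℝ) (s δ : ℝ) {t : ℝ} (ht : 0 < t) :
    phi χ s δ =ᶠ[nhds t] fun t => t ^ s * χ (δ * Real.log t) := by
  filter_upwards [eventually_gt_nhds ht] with y hy using phi_pos χ s δ hy

lemma phi_zero_left {χ : ℝ → ℝ} (hχ : ∀ y, 1 ≤ |y| → χ y = 0) (s : ℝ) {δ : ℝ} (hδ : 0 < δ) {t : ℝ}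
    (ht : t ≤ Real.exp (-(1/δ))) : phi χ s δ t = 0 := by
  rcases le_or_gt t 0 with h | h
  · simp [phi, h]
  · rw [phi_pos _ _ _ h, hχ, mul_zero]
    have : Real.log t ≤ -(1/δ) := by rw [← Real.log_exp (-(1/δ))]; exact Real.log_le_log h ht
    have h2 : δ * Real.log t ≤ -1 := by
      calc δ * Real.log t ≤ δ * (-(1/δ)) := by gcongr
        _ = -1 := by field_simp
    rw [abs_of_neg (by linarith)]; linarith

lemma phi_zero_right {χ : ℝ → ℝ} (hχ : ∀ y, 1 ≤ |y| → χ y = 0) (s : ℝ) {δ : ℝ} (hδ : 0 < δ) {t : ℝ}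
    (ht : Real.exp (1/δ) ≤ t) : phi χ s δ t = 0 := by
  have h : 0 < t := (Real.exp_pos _).trans_le ht
  rw [phi_pos _ _ _ h, hχ, mul_zero]
  have : 1/δ ≤ Real.log t := by rw [← Real.log_exp (1/δ)]; exact Real.log_le_log (Real.exp_pos _) ht
  have h2 : 1 ≤ δ * Real.log t := by
    calc (1:ℝ) = δ * (1/δ) := by field_simp
      _ ≤ δ * Real.log t := by gcongr
  rw [abs_of_pos (by linarith)]; linarith

lemma phi_contDiff {χ : ℝ → ℝ} (hc : ContDiff ℝ 2 χ) (hχ : ∀ y, 1 ≤ |y| → χ y = 0) (s : ℝ) {δ : ℝ}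
    (hδ : 0 < δ) : ContDiff ℝ 2 (phi χ s δ) := by
  rw [contDiff_iff_contDiffAt]
  intro t
  rcases lt_or_ge t (Real.exp (-(1/δ))) with h | h
  · have : phi χ s δ =ᶠ[nhds t] fun _ => 0 := by
      filter_upwards [eventually_lt_nhds h] with y hy using phi_zero_left hχ s hδ hy.le
    exact contDiffAt_const.congr_of_eventuallyEq this
  · have ht : 0 < t := (Real.exp_pos _).trans_le h
    refine ContDiffAt.congr_of_eventuallyEq ?_ (phi_ev χ s δ ht)
    refine (Real.contDiffAt_rpow_const_of_ne ht.ne').mul ?_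
    exact hc.contDiffAt.comp t (contDiffAt_const.mul (Real.contDiffAt_log.2 ht.ne'))

lemma log_deriv_aux {χ : ℝ → ℝ} (hc : Differentiable ℝ χ) (s δ : ℝ) {t : ℝ} (ht : 0 < t) :
    HasDerivAt (fun t => t ^ s * χ (δ * Real.log t))
      (t ^ (s-1) * (s * χ (δ * Real.log t) + δ * deriv χ (δ * Real.log t))) t := by
  have h1 := Real.hasDerivAt_rpow_const (p := s) (Or.inl ht.ne')
  have h2 : HasDerivAt (fun t => χ (δ * Real.log t)) (deriv χ (δ * Real.log t) * (δ * t⁻¹)) t :=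
    ((hc _).hasDerivAt).comp t ((Real.hasDerivAt_log ht.ne').const_mul δ)
  refine (h1.fun_mul h2).congr_deriv ?_
  have : t ^ s = t ^ (s-1) * t := by rw [← Real.rpow_add_one ht.ne']; ring_nf
  rw [this]
  field_simp

lemma phi_deriv {χ : ℝ → ℝ} (hc : Differentiable ℝ χ) (s δ : ℝ) {t : ℝ} (ht : 0 < t) :
    deriv (phi χ s δ) t = t ^ (s-1) * (s * χ (δ * Real.log t) + δ * deriv χ (δ * Real.log t)) := by
  rw [(phi_ev χ s δ ht).deriv_eq]
  exact (log_deriv_aux hc s δ ht).deriv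

lemma phi_op {χ : ℝ → ℝ} (hc : ContDiff ℝ 2 χ) (s δ : ℝ) {t : ℝ} (ht : 0 < t) (m : ℝ) :
    4 * t * deriv (deriv (phi χ s δ)) t + m * deriv (phi χ s δ) t =
    t ^ (s-1) * (s * (4 * (s - 1) + m) * χ (δ * Real.log t) + 
      δ * ((4 * (2 * s - 1) + m) * deriv χ (δ * Real.log t) + 4 * δ * deriv (deriv χ) (δ * Real.log t))) := by
  have hd := hc.differentiable (by norm_num)
  have hd1 : ContDiff ℝ 1 (deriv χ) := by
    have : ContDiff ℝ (1+1) χ := by simpa [one_add_one_eq_two] using hc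
    exact (contDiff_succ_iff_deriv.1 this).2.2
  have hd2 := hd1.differentiable (by norm_num)
  have e : deriv (phi χ s δ) =ᶠ[nhds t] fun t => t ^ (s-1) * 
      ((fun y => s * χ y + δ * deriv χ y) (δ * Real.log t)) := by
    filter_upwards [eventually_gt_nhds ht] with y hy using phi_deriv hd s δ hy
  have hD : ∀ y, HasDerivAt (fun y => s * χ y + δ * deriv χ y) (s * deriv χ y + δ * deriv (deriv χ) y) y :=
    fun y => ((hd y).hasDerivAt.const_mul s).fun_add ((hd2 y).hasDerivAt.const_mul δ)
  rw [e.deriv_eq, (log_deriv_aux (fun y => (hD y).differentiableAt) (s-1) δ ht).deriv, phi_deriv hd s δ ht,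
    (hD _).deriv]
  have : t ^ (s-1) = t ^ (s-1-1) * t := by rw [← Real.rpow_add_one ht.ne']; ring_nf
  rw [this]
  ring

/-- existence of cut-off -/
lemma exists_chi : ∃ χ : ℝ → ℝ, ContDiff ℝ 2 χ ∧ (∀ y, 1 ≤ |y| → χ y = 0) ∧ (∀ y, |y| ≤ 1/2 → χ y = 1) := by
  let ψ : ContDiffBump (0:ℝ) := ⟨1/2, 1, by norm_num, by norm_num⟩
  refine ⟨ψ, ψ.contDiff, fun y hy => ψ.zero_of_le_dist ?_, fun y hy => ψ.one_of_mem_closedBall ?_⟩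
  · simpa using hy
  · rw [mem_closedBall, dist_zero_right, Real.norm_eq_abs]; exact hy

lemma u_adm {χ : ℝ → ℝ} (hc : ContDiff ℝ 2 χ) (hχ : ∀ y, 1 ≤ |y| → χ y = 0) (s : ℝ) {δ : ℝ}
    (hδ : 0 < δ) (p : MvPolynomial (Fin n) ℝ) :
    DirichletAdm {(0 : EuclideanSpace ℝ (Fin n))}ᶜ (fun y => phi χ s δ (‖y‖^2) * ev p y) :=
  rad_adm (phi_contDiff hc hχ s hδ) (Real.exp_pos (-(1/δ))) (fun t ht => phi_zero_left hχ s hδ ht)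
    (B := Real.exp (1/δ)) (fun t ht => phi_zero_right hχ s hδ ht) p

lemma exists_p (hn : 2 ≤ n) (k : ℕ) : ∃ p ∈ Harm n k, ∃ x : EuclideanSpace ℝ (Fin n), ‖x‖ = 1 ∧ ev p x = 1 := by
  have h01 : (⟨0, by omega⟩ : Fin n) ≠ ⟨1, by omega⟩ := by simp
  refine ⟨_, cpow_harm h01 k, EuclideanSpace.single ⟨0, by omega⟩ 1, by simp, ?_⟩
  exact cpow_eval h01 k _ (by simp) (by simp)

lemma u_ne {χ : ℝ → ℝ} (h1 : ∀ y, |y| ≤ 1/2 → χ y = 1) (s δ : ℝ) {p : MvPolynomial (Fin n) ℝ}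
    {x : EuclideanSpace ℝ (Fin n)} (hx : ‖x‖ = 1) (hp : ev p x = 1) : 
    ∃ x, (fun y : EuclideanSpace ℝ (Fin n) => phi χ s δ (‖y‖^2) * ev p y) x ≠ 0 := by
  refine ⟨x, ?_⟩
  simp only [hx, hp]
  rw [phi_pos _ _ _ (by norm_num), h1 _ (by simp)]
  simp

lemma ratio_nonempty (hn : 2 ≤ n) (α : ℝ) : (RellichRatioSet n α).Nonempty := by
  obtain ⟨χ, hc, h0, h1⟩ := exists_chi
  obtain ⟨p, hp, x, hx, hpx⟩ := exists_p hn 0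
  exact ⟨_, _, u_adm hc h0 0 one_pos p, u_ne h1 0 1 hx hpx, rfl⟩

set_option maxHeartbeats 2000000 in
lemma ratio_small (hn : 2 ≤ n) {α : ℝ} {k : ℕ} (hα : (α + n - 4 + 2 * k) * (n + 2 * k - α) = 0) :
    ∃ C : ℝ, ∀ δ, 0 < δ → δ ≤ 1 → ∃ q ∈ RellichRatioSet n α, q ≤ C * δ^2 := by
  obtain ⟨χ, hc, h0, h1⟩ := exists_chi
  obtain ⟨p, hp, x, hx, hpx⟩ := exists_p hn k
  set s : ℝ := -(α + n - 4 + 2 * k)/4 with hs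
  set m : ℝ := 2 * n + 4 * k with hm
  have hd1 : ContDiff ℝ 1 (deriv χ) := by
    have : ContDiff ℝ (1+1) χ := by simpa [one_add_one_eq_two] using hc
    exact (contDiff_succ_iff_deriv.1 this).2.2
  have c1 := hd1.continuous
  have c2 : Continuous (deriv (deriv χ)) := hd1.continuous_deriv (by norm_num)
  obtain ⟨M1, hM1⟩ := (isCompact_Icc (a := (-1:ℝ)) (b := 1)).exists_bound_of_continuousOn c1.continuousOn
  obtain ⟨M2, hM2⟩ := (isCompact_Icc (a := (-1:ℝ)) (b := 1)).exists_bound_of_continuousOn c2.continuousOn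
  set M := |4 * (2 * s - 1) + m| * M1 + 4 * M2 with hM
  refine ⟨2 * M^2, fun δ hδ hδ1 => ?_⟩
  have hu := u_adm hc h0 s hδ p
  have hune := u_ne h1 s δ hx hpx
  set u : EuclideanSpace ℝ (Fin n) → ℝ := fun y => phi χ s δ (‖y‖^2) * ev p y with hudef
  refine ⟨_, ⟨u, hu, hune, rfl⟩, ?_⟩
  have hdp := denom_pos (α := α - 4) hu hune
  rw [div_le_iff₀ hdp]
  set K := ∫ σ : sphere (0 : EuclideanSpace ℝ (Fin n)) 1, (ev p σ.1)^2 ∂(sig n) with hK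
  have hK0 : 0 ≤ K := integral_nonneg fun σ => sq_nonneg _
  set a := Real.exp (-(1/(2*δ))) with ha
  set b := Real.exp (1/(2*δ)) with hb
  have ha0 : 0 < a := Real.exp_pos _
  have hab : a ≤ b := Real.exp_le_exp.2 (by have : 0 < 1/(2*δ) := by positivity
                                            linarith)
  have ha2 : a^2 = Real.exp (-(1/δ)) := by rw [ha, ← Real.exp_nat_mul]; congr 1; push_cast; field_simp
  have hb2 : b^2 = Real.exp (1/δ) := by rw [hb, ← Real.exp_nat_mul]; congr 1; push_cast; field_simp
  have hsupp : ∀ x ∈ tsupport u, a ≤ ‖x‖ ∧ ‖x‖ ≤ b := by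
    intro x hx
    have := rad_supp (fun t ht => phi_zero_left h0 s hδ ht) (fun t ht => phi_zero_right h0 s hδ ht) p hx
    rw [mem_setOf_eq, ← ha2, ← hb2] at this
    exact ⟨(sq_le_sq₀ ha0.le (norm_nonneg _)).1 this.1, (sq_le_sq₀ (norm_nonneg _) (Real.exp_pos _).le).1 this.2⟩
  have hsu : ∀ x, u x ≠ 0 → a ≤ ‖x‖ ∧ ‖x‖ ≤ b := fun x hx => hsupp x (subset_tsupport _ hx)
  have hsl : ∀ x, lap u x ≠ 0 → a ≤ ‖x‖ ∧ ‖x‖ ≤ b := fun x hx => hsupp x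
    (by by_contra h; exact hx (lap_zero_of h))
  have hom := (mem_Harm.1 hp).1
  -- exponents
  have hpw : ∀ r : ℝ, 0 < r → r ^ (n-1) * (r ^ (α - 4) * ((r^2) ^ s * r ^ k)^2) = r⁻¹ := by
    intro r hr
    rw [← Real.rpow_natCast r 2, ← Real.rpow_mul hr.le, ← Real.rpow_natCast r k, ← Real.rpow_add hr,
      ← Real.rpow_natCast _ 2, ← Real.rpow_mul hr.le, ← Real.rpow_natCast r (n-1), ← Real.rpow_add hr,
      ← Real.rpow_add hr, ← Real.rpow_neg_one]
    congr 1
    push_cast [Nat.cast_sub (by omega : 1 ≤ n)]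
    rw [hs]; ring
  have hpw2 : ∀ r : ℝ, 0 < r → r ^ (n-1) * (r ^ α * ((r^2) ^ (s-1) * r ^ k)^2) = r⁻¹ := by
    intro r hr
    rw [← hpw r hr, Real.rpow_sub_one (by positivity)]
    have e4 : r ^ α = r ^ (α - 4) * r ^ 4 := by
      rw [← Real.rpow_natCast r 4, ← Real.rpow_add hr]; congr 1; push_cast; ring
    rw [e4]
    field_simp
  have hlog : ∀ r : ℝ, δ * Real.log (r^2) = 2 * δ * Real.log r := by
    intro r; rw [Real.log_pow]; push_cast; ring
  -- denominator
  have hD : ∫ x, ‖x‖ ^ (α - 4) * (u x)^2 = K * ∫ r in a..b, r⁻¹ * (χ (2 * δ * Real.log r))^2 := by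
    rw [polar_ab hn (weight_cont hu.1.continuous ha0 hsu _) ha0 hab (fun x hx => hsu x fun h => hx (by simp [h])),
      ← intervalIntegral.integral_const_mul]
    refine intervalIntegral.integral_congr fun r hr => ?_
    rw [uIcc_of_le hab] at hr
    have hr0 : 0 < r := ha0.trans_le hr.1
    simp only [hudef, sph_norm hr0.le, ev_smul hom, phi_pos _ _ _ (pow_pos hr0 2), hlog]
    rw [← hpw r hr0, hK, mul_comm (∫ σ, _ ∂_) _, ← integral_const_mul, ← integral_const_mul]
    congr 1; ext σ; ring
  -- numerator
  have hz : s * (4 * (s - 1) + m) = 0 := by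
    rw [hs, hm]; linear_combination (-1/4) * hα
  have hN : ∫ x, ‖x‖ ^ α * (lap u x)^2 = K * ∫ r in a..b, r⁻¹ * 
      (δ * ((4 * (2 * s - 1) + m) * deriv χ (2 * δ * Real.log r) + 4 * δ * deriv (deriv χ) (2 * δ * Real.log r)))^2 := by
    rw [polar_ab hn (weight_cont (lap_continuous hu.1) ha0 hsl _) ha0 hab (fun x hx => hsl x fun h => hx (by simp [h])),
      ← intervalIntegral.integral_const_mul]
    refine intervalIntegral.integral_congr fun r hr => ?_
    rw [uIcc_of_le hab] at hr
    have hr0 : 0 < r := ha0.trans_le hr.1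
    have hl : ∀ σ : sphere (0 : EuclideanSpace ℝ (Fin n)) 1, lap u (r • σ.1) = _ := fun σ =>
      lap_radial_mul hp (phi_contDiff hc h0 s hδ).contDiffAt
    simp only [hl, sph_norm hr0.le, ev_smul hom]
    rw [phi_op hc s δ (pow_pos hr0 2), hz, hlog, ← hpw2 r hr0, hK, mul_comm (∫ σ, _ ∂_) _, ← integral_const_mul, ← integral_const_mul]
    congr 1; ext σ; ring
  have hpos : ∀ r ∈ uIcc a b, 0 < r := by
    intro r hr
    rw [uIcc_of_le hab] at hr
    exact ha0.trans_le hr.1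
  have cinv : ContinuousOn (fun r : ℝ => r⁻¹) (uIcc a b) := continuousOn_inv₀.mono fun r hr => (hpos r hr).ne'
  have clog : ContinuousOn Real.log (uIcc a b) := Real.continuousOn_log.mono fun r hr => (hpos r hr).ne'
  have cχ := hc.continuous
  have hNb : ∫ r in a..b, r⁻¹ * 
      (δ * ((4 * (2 * s - 1) + m) * deriv χ (2 * δ * Real.log r) + 4 * δ * deriv (deriv χ) (2 * δ * Real.log r)))^2 
      ≤ (δ * M)^2 * (1/δ) := by
    have e1 : ∫ r in a..b, r⁻¹ * (δ * M)^2 = (δ * M)^2 * (1/δ) := by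
      rw [intervalIntegral.integral_mul_const, integral_inv_of_pos ha0 (Real.exp_pos _), Real.log_div (Real.exp_pos _).ne' ha0.ne', ha,
        Real.log_exp, Real.log_exp]
      field_simp; ring
    rw [← e1]
    refine intervalIntegral.integral_mono_on hab ?_ ?_ ?_
    · exact ContinuousOn.intervalIntegrable (by fun_prop)
    · exact ContinuousOn.intervalIntegrable (by fun_prop)
    · intro r hr
      have hr0 : 0 < r := ha0.trans_le hr.1
      have hy : 2 * δ * Real.log r ∈ Icc (-1:ℝ) 1 := by
        have l1 : -(1/(2*δ)) ≤ Real.log r := by rw [Real.le_log_iff_exp_le hr0]; exact hr.1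
        have l2 : Real.log r ≤ 1/(2*δ) := by rw [Real.log_le_iff_le_exp hr0]; exact hr.2
        constructor
        · calc (-1:ℝ) = 2 * δ * (-(1/(2*δ))) := by field_simp
            _ ≤ _ := by gcongr
        · calc _ ≤ 2 * δ * (1/(2*δ)) := by gcongr
            _ = 1 := by field_simp
      have b1 := hM1 _ hy
      have b2 := hM2 _ hy
      rw [Real.norm_eq_abs] at b1 b2
      refine mul_le_mul_of_nonneg_left ?_ (inv_nonneg.2 hr0.le)
      rw [mul_pow, mul_pow]
      refine mul_le_mul_of_nonneg_left ?_ (sq_nonneg _)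
      have hb3 : |(4 * (2 * s - 1) + m) * deriv χ (2 * δ * Real.log r) +
          4 * δ * deriv (deriv χ) (2 * δ * Real.log r)| ≤ M := by
        refine (abs_add_le _ _).trans ?_
        rw [abs_mul, abs_mul, abs_of_pos (by positivity : 0 < 4 * δ), hM]
        have b3 : 4 * δ * |deriv (deriv χ) (2 * δ * Real.log r)| ≤ 4 * M2 := by
          have := abs_nonneg (deriv (deriv χ) (2 * δ * Real.log r))
          nlinarith
        have b4 := mul_le_mul_of_nonneg_left b1 (abs_nonneg (4 * (2 * s - 1) + m))
        linarith
      exact sq_le_sq' (neg_le_of_abs_le hb3) (le_of_abs_le hb3)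
  have hDb : 1/(2*δ) ≤ ∫ r in a..b, r⁻¹ * (χ (2 * δ * Real.log r))^2 := by
    have l0 : 0 < 1/(4*δ) := by positivity
    have l1 : 1/(4*δ) ≤ 1/(2*δ) := by gcongr; norm_num
    have hab' : Real.exp (-(1/(4*δ))) ≤ Real.exp (1/(4*δ)) := Real.exp_le_exp.2 (by linarith)
    have e1 : ∫ r in (Real.exp (-(1/(4*δ))))..(Real.exp (1/(4*δ))), r⁻¹ * (χ (2 * δ * Real.log r))^2 = 1/(2*δ) := by
      have : ∫ r in (Real.exp (-(1/(4*δ))))..(Real.exp (1/(4*δ))), r⁻¹ = 1/(2*δ) := by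
        rw [integral_inv_of_pos (Real.exp_pos _) (Real.exp_pos _), Real.log_div (Real.exp_pos _).ne' (Real.exp_pos _).ne',
          Real.log_exp, Real.log_exp]
        field_simp; ring
      rw [← this]
      refine intervalIntegral.integral_congr fun r hr => ?_
      rw [uIcc_of_le hab'] at hr
      have hr0 : 0 < r := (Real.exp_pos _).trans_le hr.1
      have l1 : -(1/(4*δ)) ≤ Real.log r := by rw [Real.le_log_iff_exp_le hr0]; exact hr.1
      have l2 : Real.log r ≤ 1/(4*δ) := by rw [Real.log_le_iff_le_exp hr0]; exact hr.2
      have : |2 * δ * Real.log r| ≤ 1/2 := by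
        rw [abs_le]
        constructor
        · calc -(1/2:ℝ) = 2 * δ * (-(1/(4*δ))) := by field_simp; norm_num
            _ ≤ _ := by gcongr
        · calc _ ≤ 2 * δ * (1/(4*δ)) := by gcongr
            _ = 1/2 := by field_simp; norm_num
      simp [h1 _ this]
    rw [← e1]
    refine intervalIntegral.integral_mono_interval (Real.exp_le_exp.2 (by linarith)) hab' (Real.exp_le_exp.2 l1) ?_ ?_
    · refine (ae_restrict_iff' measurableSet_Ioc).2 (Eventually.of_forall fun r hr => ?_)
      have : 0 < r := ha0.trans hr.1
      simp only [Pi.zero_apply]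
      positivity
    · exact ContinuousOn.intervalIntegrable (by fun_prop)
  rw [hN, hD]
  calc _ ≤ K * ((δ * M)^2 * (1/δ)) := by gcongr
    _ = 2 * M^2 * δ^2 * (K * (1/(2*δ))) := by field_simp
    _ ≤ _ := by gcongr

lemma rellich_sInf_zero (hn : 2 ≤ n) {α : ℝ} {k : ℕ} (hα : (α + n - 4 + 2 * k) * (n + 2 * k - α) = 0) :
    sInf (RellichRatioSet n α) = 0 := by
  refine le_antisymm ?_ (Real.sInf_nonneg ratio_nonneg)
  obtain ⟨C, hC⟩ := ratio_small hn hα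
  have hb : BddBelow (RellichRatioSet n α) := ⟨0, ratio_nonneg⟩
  have hle : ∀ᶠ δ in nhdsWithin (0:ℝ) (Ioi 0), sInf (RellichRatioSet n α) ≤ C * δ^2 := by
    filter_upwards [Ioc_mem_nhdsGT one_pos] with δ hδ
    obtain ⟨q, hq, hq2⟩ := hC δ hδ.1 hδ.2
    exact (csInf_le hb hq).trans hq2
  have ht : Tendsto (fun δ : ℝ => C * δ^2) (nhdsWithin (0:ℝ) (Ioi 0)) (nhds 0) := by
    have : Continuous fun δ : ℝ => C * δ^2 := by fun_prop
    simpa using (this.tendsto 0).mono_left nhdsWithin_le_nhds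
  exact ge_of_tendsto ht hle

theorem main_thm {n : ℕ} (hn : 2 ≤ n) (α : ℝ) :
    sInf (RellichRatioSet n α) = 0 ↔
      (∃ k : ℕ, α = (n : ℝ) + 2 * (k : ℝ)) ∨
      (∃ k : ℕ, α = 4 - (n : ℝ) - 2 * (k : ℝ)) := by
  constructor
  · intro h
    by_contra hcon
    push Not at hcon
    exact (rellich_pos hn (ratio_nonempty hn α) hcon.1 hcon.2).ne' h
  · rintro (⟨k, hk⟩ | ⟨k, hk⟩)
    · exact rellich_sInf_zero hn (k := k) (by rw [hk]; ring)
    · exact rellich_sInf_zero hn (k := k) (by rw [hk]; ring)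

end Sharp

/-- `μ_{n,α} = 0` if and only if
`α ∈ {n + 2k : k ∈ ℕ} ∪ {4 - n - 2k : k ∈ ℕ}`. -/
theorem rellich_constant_zero_iff {n : ℕ} (hn : 2 ≤ n) (α : ℝ) :
    sInf (RellichRatioSet n α) = 0 ↔
      (∃ k : ℕ, α = (n : ℝ) + 2 * (k : ℝ)) ∨
      (∃ k : ℕ, α = 4 - (n : ℝ) - 2 * (k : ℝ)) := by
  exact main_thm hn α

end
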